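/- arXiv:2604.23450 — 8 statements merged into one kernel-verified Lean document; each statement's English description precedes it below -/
import Mathlib

section
/- Let P = p₁p₂⋯p_t be a product of distinct primes each congruent to 1 modulo 8, and suppose P = 2e² − f² = u² + 2v², where e, f, u are odd positive integers and v is an even positive integer. Then e ≡ 1 (mod 4) if and only if v ≡ 0 (mod 4). (Equivalently, the Jacobi symbol (−1/e) equals 1 if and only if v ≡ 0 (mod 4).) -/
/-- A prime congruent to `3` modulo `4` dividing a sum of two squares divides the second term. -/
theorem dvd_right_of_dvd_sq_add_sq {q a b : ℕ} (hq : q.Prime) (hq3 : q % 4 = 3)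
    (h : q ∣ a ^ 2 + b ^ 2) : q ∣ b := by
  have : Fact q.Prime := ⟨hq⟩
  by_contra hb
  have hb' : (b : ZMod q) ≠ 0 := fun h0 => hb ((ZMod.natCast_eq_zero_iff b q).1 h0)
  have hs : ((a ^ 2 + b ^ 2 : ℕ) : ZMod q) = 0 := (ZMod.natCast_eq_zero_iff _ q).2 h
  push_cast at hs
  exact ZMod.mod_four_ne_three_of_sq_eq_neg_sq' hb' (eq_neg_of_add_eq_zero_left hs) hq3

/-- If `2 * (n * m)` is a sum of two squares, `n` is odd, and no prime congruent to `3` modulo `4`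
divides both `n` and `m`, then `n` is congruent to `1` modulo `4`. -/
theorem mod_four_eq_one_of_two_mul_mul_eq_sq_add_sq {n m a b : ℕ} (hn : Odd n) (hm : m ≠ 0)
    (hcop : ∀ q : ℕ, q.Prime → q % 4 = 3 → q ∣ n → ¬ q ∣ m)
    (h : 2 * (n * m) = a ^ 2 + b ^ 2) : n % 4 = 1 := by
  have hn0 : n ≠ 0 := hn.pos.ne'
  have hsum : ∃ x y : ℕ, n = x ^ 2 + y ^ 2 := by
    rw [Nat.eq_sq_add_sq_iff]
    intro q hqn hq3
    have hq : q.Prime := Nat.prime_of_mem_primeFactors hqn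
    have hqdvd : q ∣ n := Nat.dvd_of_mem_primeFactors hqn
    have : Fact q.Prime := ⟨hq⟩
    have heven := Nat.eq_sq_add_sq_iff.1 ⟨a, b, h⟩ q
      (Nat.mem_primeFactors.2 ⟨hq, (hqdvd.mul_right m).mul_left 2, by positivity⟩) hq3
    have hq2 : ¬ q ∣ 2 := fun h2 => by
      rw [(Nat.prime_dvd_prime_iff_eq hq Nat.prime_two).1 h2] at hq3
      omega
    rwa [padicValNat.mul two_ne_zero (mul_ne_zero hn0 hm), padicValNat.mul hn0 hm,
      padicValNat.eq_zero_of_not_dvd hq2,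
      padicValNat.eq_zero_of_not_dvd (hcop q hq hq3 hqdvd), zero_add, add_zero] at heven
  obtain ⟨x, y, hxy⟩ := hsum
  have sq_mod (z : ℕ) : z ^ 2 % 4 = 0 ∨ z ^ 2 % 4 = 1 := by
    have hz : z % 4 < 4 := Nat.mod_lt _ (by norm_num)
    rw [Nat.pow_mod]
    interval_cases z % 4 <;> simp
  have hx := sq_mod x
  have hy := sq_mod y
  rw [Nat.odd_iff] at hn
  omega

theorem stmt2 (P : ℕ) (hsf : Squarefree P)
    (hfac : ∀ r : ℕ, r.Prime → r ∣ P → r % 8 = 1)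
    (e f u v : ℕ)
    (he : Odd e) (hf : Odd f) (hu : Odd u) (hv : Even v)
    (he0 : 0 < e) (hf0 : 0 < f) (hu0 : 0 < u) (hv0 : 0 < v)
    (h1 : (P : ℤ) = 2 * e ^ 2 - f ^ 2) (h2 : (P : ℤ) = u ^ 2 + 2 * v ^ 2) :
    e % 4 = 1 ↔ v % 4 = 0 := by
  have hlt : v < e := by
    zify
    zify at hf0
    nlinarith
  obtain ⟨m, rfl⟩ := Nat.exists_eq_add_of_lt hlt
  have key : 2 * ((v + m + 1 + v) * (m + 1)) = u ^ 2 + f ^ 2 := by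
    zify
    push_cast at h1
    linarith
  have hmod : (v + m + 1 + v) % 4 = 1 := by
    refine mod_four_eq_one_of_two_mul_mul_eq_sq_add_sq (he.add_even hv) (Nat.succ_ne_zero m) ?_ key
    intro q hq hq3 hqn hqm
    have hqf : q ∣ f :=
      dvd_right_of_dvd_sq_add_sq hq hq3 (key ▸ (hqn.mul_right _).mul_left 2)
    have hq2v : q ∣ 2 * v := by
      have h := Nat.dvd_sub hqn hqm
      rwa [show v + m + 1 + v - (m + 1) = 2 * v by omega] at h
    have hqe : q ∣ v + m + 1 := by
      rcases hq.dvd_mul.1 hq2v with h | h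
      · rw [(Nat.prime_dvd_prime_iff_eq hq Nat.prime_two).1 h] at hq3
        omega
      · simpa only [add_assoc] using Nat.dvd_add h hqm
    have hqP : q ∣ P := by
      zify at hqe hqf ⊢
      rw [h1]
      push_cast
      exact ((dvd_pow hqe two_ne_zero).mul_left 2).sub (dvd_pow hqf two_ne_zero)
    have := hfac q hq hqP
    omega
  rw [Nat.even_iff] at hv
  omega
end

section
/- Let t ≥ 1, let p₁, …, p_t be distinct primes with p_i ≡ 1 (mod 8), and let q be a prime with q ≡ 3 (mod 8) such that q is a quadratic residue modulo each p_i. Set p_{t+1} = q and let n = p₁⋯p_t·q. Let M be the Monsky matrix of n over 𝔽₂, a 2(t+1)×2(t+1) block matrix M = [[C+D₂, D₂],[D₂, C+D₋₂]], where for l ∈ {2, −2}, D_l is the (t+1)×(t+1) diagonal matrix with i-th diagonal entry 0 if the Legendre symbol (l/p_i) = 1 and 1 if (l/p_i) = −1, and C is the (t+1)×(t+1) matrix with off-diagonal entries c_{ij} = 0 if (p_j/p_i) = 1 and c_{ij} = 1 if (p_j/p_i) = −1 (j ≠ i) and diagonal entries c_{ii} = Σ_{j≠i} c_{ij}. If the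 matrix A_n has rank t−1 over 𝔽₂, then M has rank 2t over 𝔽₂. -/
open scoped Classical in
/-- The matrix over `𝔽₂` attached to the odd primes `p 0, …, p (t-1)`:
off-diagonal entry `(i,j)` is `0` if `p j` is a quadratic residue mod `p i`
and `1` otherwise, and the diagonal entry `(i,i)` is the sum of the
off-diagonal entries in row `i`. (This is both the matrix `A_n` and the
block `C` of the Monsky matrix.) -/
noncomputable def AMatrix (t : ℕ) (p : Fin t → ℕ) : Matrix (Fin t) (Fin t) (ZMod 2) :=
  Matrix.of fun i j =>
    if i = j then
      ∑ k ∈ Finset.univ.erase i, (if IsSquare ((p k : ZMod (p i))) then (0 : ZMod 2) else 1)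
    else if IsSquare ((p j : ZMod (p i))) then 0 else 1

open scoped Classical in
/-- The diagonal matrix `D_l` over `𝔽₂`: the `i`-th diagonal entry is `0`
if `l` is a quadratic residue mod `p i` and `1` otherwise. -/
noncomputable def DiagMatrix (t : ℕ) (p : Fin t → ℕ) (l : ℤ) :
    Matrix (Fin t) (Fin t) (ZMod 2) :=
  Matrix.diagonal fun i => if IsSquare ((l : ZMod (p i))) then 0 else 1

/-- The Monsky matrix `[[C + D₂, D₂], [D₂, C + D₋₂]]` over `𝔽₂` attached to
the odd primes `p 0, …, p (t-1)`. -/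
noncomputable def MonskyMatrix (t : ℕ) (p : Fin t → ℕ) :
    Matrix (Fin t ⊕ Fin t) (Fin t ⊕ Fin t) (ZMod 2) :=
  Matrix.fromBlocks (AMatrix t p + DiagMatrix t p 2) (DiagMatrix t p 2)
    (DiagMatrix t p 2) (AMatrix t p + DiagMatrix t p (-2))

open scoped Classical in
/-- The additive Legendre symbol: `0` if `a` is a square modulo `m` and `1` otherwise. -/
noncomputable def nonresidueBit (a : ℤ) (m : ℕ) : ZMod 2 :=
  if IsSquare ((a : ZMod m)) then 0 else 1

lemma nonresidueBit_eq_zero {a : ℤ} {m : ℕ} (h : IsSquare ((a : ZMod m))) :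
    nonresidueBit a m = 0 :=
  if_pos h

lemma nonresidueBit_eq_one {a : ℤ} {m : ℕ} (h : ¬ IsSquare ((a : ZMod m))) :
    nonresidueBit a m = 1 :=
  if_neg h

open scoped Classical in
lemma nonresidueBit_natCast (a m : ℕ) :
    nonresidueBit a m = if IsSquare ((a : ZMod m)) then 0 else 1 := by
  rw [nonresidueBit, Int.cast_natCast]

lemma AMatrix_apply_of_ne {t : ℕ} (p : Fin t → ℕ) {i j : Fin t} (h : i ≠ j) :
    AMatrix t p i j = nonresidueBit (p j) (p i) := by
  simp [AMatrix, nonresidueBit_natCast, h]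

lemma AMatrix_apply_self {t : ℕ} (p : Fin t → ℕ) (i : Fin t) :
    AMatrix t p i i = ∑ k, if k = i then 0 else nonresidueBit (p k) (p i) := by
  rw [← Finset.add_sum_erase _ _ (Finset.mem_univ i), if_pos rfl, zero_add]
  simp only [AMatrix, Matrix.of_apply, if_true]
  refine Finset.sum_congr rfl fun k hk => ?_
  rw [if_neg (Finset.ne_of_mem_erase hk), nonresidueBit_natCast]

lemma DiagMatrix_eq_diagonal {t : ℕ} (p : Fin t → ℕ) (l : ℤ) :
    DiagMatrix t p l = Matrix.diagonal fun i => nonresidueBit l (p i) :=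
  rfl

section Snoc

variable {t : ℕ} {p : Fin t → ℕ} {q : ℕ}

lemma AMatrix_snoc_castSucc_castSucc (h : ∀ i, nonresidueBit q (p i) = 0) (i j : Fin t) :
    AMatrix (t + 1) (Fin.snoc p q) i.castSucc j.castSucc = AMatrix t p i j := by
  rcases eq_or_ne i j with rfl | hij
  · simp [AMatrix_apply_self, Fin.sum_univ_castSucc, h]
  · rw [AMatrix_apply_of_ne _ hij,
      AMatrix_apply_of_ne _ fun h => hij (Fin.castSucc_injective t h)]
    simp

lemma AMatrix_snoc_castSucc_last (h : ∀ i, nonresidueBit q (p i) = 0) (i : Fin t) :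
    AMatrix (t + 1) (Fin.snoc p q) i.castSucc (Fin.last t) = 0 := by
  rw [AMatrix_apply_of_ne _ (Fin.castSucc_ne_last i)]
  simp [h]

lemma AMatrix_snoc_last_castSucc (h : ∀ i, nonresidueBit (p i) q = 0) (i : Fin t) :
    AMatrix (t + 1) (Fin.snoc p q) (Fin.last t) i.castSucc = 0 := by
  rw [AMatrix_apply_of_ne _ (Fin.castSucc_ne_last i).symm]
  simp [h]

lemma AMatrix_snoc_last_last (h : ∀ i, nonresidueBit (p i) q = 0) :
    AMatrix (t + 1) (Fin.snoc p q) (Fin.last t) (Fin.last t) = 0 := by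
  simp [AMatrix_apply_self, Fin.sum_univ_castSucc, h]

/-- Splits the two copies of `Fin (t + 1)` into their initial segments and their last elements. -/
def sumFinSuccEquiv (t : ℕ) :
    (Fin t ⊕ Fin t) ⊕ (Fin 1 ⊕ Fin 1) ≃ Fin (t + 1) ⊕ Fin (t + 1) :=
  (Equiv.sumSumSumComm _ _ _ _).trans (Equiv.sumCongr finSumFinEquiv finSumFinEquiv)

lemma MonskyMatrix_snoc_submatrix (h : ∀ i, nonresidueBit q (p i) = 0)
    (h' : ∀ i, nonresidueBit (p i) q = 0)
    (h2 : ∀ i, nonresidueBit 2 (p i) = 0) (hneg2 : ∀ i, nonresidueBit (-2) (p i) = 0)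
    (hq2 : nonresidueBit 2 q = 1) (hqneg2 : nonresidueBit (-2) q = 0) :
    (MonskyMatrix (t + 1) (Fin.snoc p q)).submatrix (sumFinSuccEquiv t) (sumFinSuccEquiv t) =
      Matrix.fromBlocks (Matrix.fromBlocks (AMatrix t p) 0 0 (AMatrix t p)) 0 0
        (Matrix.fromBlocks 1 1 1 0) := by
  have hlast (i : Fin 1) : Fin.natAdd t i = Fin.last t := by
    ext; simp
  have hcast (i : Fin t) : Fin.castAdd 1 i = i.castSucc := rfl
  ext (i | i) (j | j) <;> rcases i with i | i <;> rcases j with j | j <;>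
    simp [MonskyMatrix, sumFinSuccEquiv, DiagMatrix_eq_diagonal, Matrix.diagonal_apply, hlast,
      hcast, AMatrix_snoc_castSucc_castSucc h, AMatrix_snoc_castSucc_last h,
      AMatrix_snoc_last_castSucc h', AMatrix_snoc_last_last h', h2, hneg2, hq2, hqneg2,
      Fin.fin_one_eq_zero, (Fin.castSucc_ne_last _).symm]

end Snoc

lemma Matrix.rank_fromBlocks_zero_zero {K l m n o : Type*} [Field K] [Fintype l] [Fintype m]
    [Fintype n] [Fintype o] (A : Matrix l m K) (D : Matrix n o K) :
    (Matrix.fromBlocks A 0 0 D).rank = A.rank + D.rank := by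
  let e := LinearEquiv.sumArrowLequivProdArrow l n K K
  let f := LinearEquiv.sumArrowLequivProdArrow m o K K
  have hcomp : e.toLinearMap ∘ₗ (Matrix.fromBlocks A 0 0 D).mulVecLin =
      (A.mulVecLin.prodMap D.mulVecLin) ∘ₗ f.toLinearMap := by
    refine LinearMap.ext fun x => ?_
    refine Prod.ext ?_ ?_ <;> funext i <;>
      simp [e, f, Matrix.fromBlocks_mulVec] <;> rfl
  have hrange : (Matrix.fromBlocks A 0 0 D).mulVecLin.range.map e.toLinearMap =
      A.mulVecLin.range.prod D.mulVecLin.range := by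
    rw [← LinearMap.range_comp, hcomp, LinearMap.range_comp, LinearEquiv.range,
      Submodule.map_top, LinearMap.range_prodMap]
  simp only [Matrix.rank]
  rw [← LinearEquiv.finrank_map_eq e, hrange, ← Module.finrank_prod,
    ← LinearMap.finrank_range_of_inj (f := A.mulVecLin.range.subtype.prodMap
      D.mulVecLin.range.subtype) (Subtype.val_injective.prodMap Subtype.val_injective),
    LinearMap.range_prodMap, Submodule.range_subtype, Submodule.range_subtype]

theorem stmt4 (t : ℕ) (ht : 1 ≤ t) (p : Fin t → ℕ) (q : ℕ)
    (hp : ∀ i, (p i).Prime) (hpmod : ∀ i, p i % 8 = 1) (hinj : Function.Injective p)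
    (hq : q.Prime) (hqmod : q % 8 = 3) (hqp : ∀ i, q ≠ p i)
    (hQR : ∀ i, IsSquare ((q : ZMod (p i))))
    (hrank : (AMatrix t p).rank = t - 1) :
    (MonskyMatrix (t + 1) (Fin.snoc p q)).rank = 2 * t := by
  have := Fact.mk hq
  have hfact (i) := Fact.mk (hp i)
  have h : ∀ i, nonresidueBit q (p i) = 0 := fun i =>
    nonresidueBit_eq_zero (by simpa using hQR i)
  have h' : ∀ i, nonresidueBit (p i) q = 0 := fun i => nonresidueBit_eq_zero <| by
    have := (ZMod.exists_sq_eq_prime_iff_of_mod_four_eq_one (p := p i) (q := q)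
      (by have := hpmod i; lia) (by lia)).1 (hQR i)
    simpa using this
  have h2 : ∀ i, nonresidueBit 2 (p i) = 0 := fun i => nonresidueBit_eq_zero <| by
    have := (ZMod.exists_sq_eq_two_iff (p := p i) (by have := hpmod i; lia)).2 (.inl (hpmod i))
    simpa using this
  have hneg2 : ∀ i, nonresidueBit (-2) (p i) = 0 := fun i => nonresidueBit_eq_zero <| by
    have := (ZMod.exists_sq_eq_neg_two_iff (p := p i) (by have := hpmod i; lia)).2
      (.inl (hpmod i))
    simpa using this
  have hq2 : nonresidueBit 2 q = 1 := nonresidueBit_eq_one <| by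
    have := (ZMod.exists_sq_eq_two_iff (p := q) (by lia)).not.2 (by lia)
    simpa using this
  have hqneg2 : nonresidueBit (-2) q = 0 := nonresidueBit_eq_zero <| by
    have := (ZMod.exists_sq_eq_neg_two_iff (p := q) (by lia)).2 (.inr hqmod)
    simpa using this
  have hcorner : (Matrix.fromBlocks 1 1 1 0 :
      Matrix (Fin 1 ⊕ Fin 1) (Fin 1 ⊕ Fin 1) (ZMod 2)).rank = 2 := by
    rw [Matrix.rank_of_det_ne_zero]
    · simp
    · rw [Matrix.det_fromBlocks_one₁₁]
      simp
  rw [← Matrix.rank_submatrix _ (sumFinSuccEquiv t) (sumFinSuccEquiv t),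
    MonskyMatrix_snoc_submatrix h h' h2 hneg2 hq2 hqneg2, Matrix.rank_fromBlocks_zero_zero,
    Matrix.rank_fromBlocks_zero_zero, hrank, hcorner]
  lia
end

section
/- Let t ≥ 1, let p₁, …, p_t be distinct primes with p_i ≡ 1 (mod 8), let q be a prime with q ≡ 3 (mod 8) distinct from the p_i, and set n_q = p₁p₂⋯p_t and n = n_q·q. Assume that q is a quadratic residue modulo p_i for every i and that the matrix A_n has rank t−1 over 𝔽₂. Then 2^{t+1} divides h(−n) and 2^{t+1} divides h(−n_q). -/
/-- `K` is a quadratic field `ℚ(√m)`: it contains a square root `α` of `m`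
and every element is of the form `a + b * α` with `a, b ∈ ℚ`. -/
def IsQuadSqrtField (K : Type) [Field K] (m : ℤ) : Prop :=
  ∃ α : K, α ^ 2 = (m : K) ∧ ∀ x : K, ∃ a b : ℚ, x = (a : K) + (b : K) * α

section QuadraticField

open NumberField

variable {K : Type} [Field K] {d : ℤ} {α : K}

lemma exists_ringOfIntegers_sq_eq (hα : α ^ 2 = (d : K)) : ∃ β : 𝓞 K, (β : K) = α := by
  have h : IsIntegral ℤ α := by
    refine IsIntegral.of_pow (n := 2) two_pos ?_
    rw [hα]
    exact isIntegral_algebraMap (R := ℤ) (A := K) (x := d)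
  exact ⟨⟨α, h⟩, rfl⟩

lemma sq_eq_of_coe_eq (hα : α ^ 2 = (d : K)) {β : 𝓞 K} (hβ : (β : K) = α) :
    β ^ 2 = (d : 𝓞 K) := by
  apply RingOfIntegers.ext
  simp [hβ, hα]

variable [NumberField K]

lemma quadratic_norm (hd : d < 0) (hα : α ^ 2 = (d : K))
    (hgen : ∀ x : K, ∃ a b : ℚ, x = (a : K) + (b : K) * α) (a b : ℚ) :
    Algebra.norm ℚ ((a : K) + (b : K) * α) = a ^ 2 - d * b ^ 2 := by
  have hli : LinearIndependent ℚ ![(1 : K), α] := by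
    rw [LinearIndependent.pair_iff]
    intro s r h
    simp only [Rat.smul_def, mul_one] at h
    have hsq : s ^ 2 = d * r ^ 2 := by
      have : ((s ^ 2 : ℚ) : K) = ((d * r ^ 2 : ℚ) : K) := by
        push_cast
        linear_combination (s - r * α) * h + (r : K) ^ 2 * hα
      exact_mod_cast this
    have hd' : (d : ℚ) < 0 := by exact_mod_cast hd
    have hr : r = 0 := by
      by_contra hr
      nlinarith [sq_nonneg s, mul_neg_of_neg_of_pos hd' (show 0 < r ^ 2 by positivity)]
    refine ⟨?_, hr⟩
    simpa [hr] using hsq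
  have hspan : ⊤ ≤ Submodule.span ℚ (Set.range ![(1 : K), α]) := by
    intro x _
    obtain ⟨u, v, rfl⟩ := hgen x
    rw [Matrix.range_cons, Matrix.range_cons, Matrix.range_empty, Set.union_empty,
      Set.singleton_union, Submodule.mem_span_pair]
    exact ⟨u, v, by simp [Rat.smul_def]⟩
  let B := Module.Basis.mk hli hspan
  have hB0 : B 0 = 1 := by simp [B]
  have hB1 : B 1 = α := by simp [B]
  have hrepr : ∀ u v : ℚ, ∀ i, B.repr ((u : K) + (v : K) * α) i = ![u, v] i := by
    intro u v i
    have : (u : K) + (v : K) * α = u • B 0 + v • B 1 := by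
      simp [hB0, hB1, Rat.smul_def]
    rw [this]
    fin_cases i <;> simp
  have hmul : ((a : K) + b * α) * α = ((d * b : ℚ) : K) + (a : K) * α := by
    push_cast
    linear_combination (b : K) * hα
  rw [Algebra.norm_eq_matrix_det B, Matrix.det_fin_two]
  simp only [Algebra.leftMulMatrix_eq_repr_mul, hB0, hB1, mul_one, hmul, hrepr]
  simp
  ring

lemma quadratic_norm_int (hd : d < 0) (hα : α ^ 2 = (d : K))
    (hgen : ∀ x : K, ∃ a b : ℚ, x = (a : K) + (b : K) * α) {β : 𝓞 K} (hβ : (β : K) = α)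
    (m k : ℤ) : Algebra.norm ℤ ((m : 𝓞 K) + k * β) = m ^ 2 - d * k ^ 2 := by
  have h := Algebra.coe_norm_int ((m : 𝓞 K) + (k : 𝓞 K) * β)
  have h2 := quadratic_norm hd hα hgen m k
  have h3 : (((m : 𝓞 K) + (k : 𝓞 K) * β : 𝓞 K) : K) = ((m : ℚ) : K) + ((k : ℚ) : K) * α := by
    simp [hβ]
  rw [h3, h2] at h
  exact_mod_cast h

lemma quadratic_absNorm_span_pair (hd : d < 0) (hα : α ^ 2 = (d : K))
    (hgen : ∀ x : K, ∃ a b : ℚ, x = (a : K) + (b : K) * α) {β : 𝓞 K} (hβ : (β : K) = α)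
    {l : ℕ} (hl : l.Prime) {b : ℤ} (hdvd : (l : ℤ) ∣ b ^ 2 - d)
    (hndvd : ¬ (l : ℤ) ^ 2 ∣ b ^ 2 - d) :
    Ideal.absNorm (Ideal.span {(l : 𝓞 K), (b : 𝓞 K) + β}) = l := by
  set I := Ideal.span {(l : 𝓞 K), (b : 𝓞 K) + β} with hI
  have hN : ∀ m k : ℤ, Algebra.norm ℤ ((m : 𝓞 K) + k * β) = m ^ 2 - d * k ^ 2 :=
    quadratic_norm_int hd hα hgen hβ
  have hNl : Algebra.norm ℤ (l : 𝓞 K) = (l : ℤ) ^ 2 := by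
    simpa using hN l 0
  have h1 : (Ideal.absNorm I : ℤ) ∣ (l : ℤ) ^ 2 := by
    rw [← hNl]
    exact Ideal.absNorm_dvd_norm_of_mem (Ideal.subset_span (by simp))
  have h2 : (Ideal.absNorm I : ℤ) ∣ b ^ 2 - d := by
    have := hN b 1
    simp only [Int.cast_one, one_mul, one_pow, mul_one] at this
    rw [← this]
    exact Ideal.absNorm_dvd_norm_of_mem (Ideal.subset_span (by simp))
  have h1' : Ideal.absNorm I ∣ l ^ 2 := by exact_mod_cast h1
  obtain ⟨k, hk, hk'⟩ := (Nat.dvd_prime_pow hl).1 h1'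
  interval_cases k
  · exfalso
    rw [pow_zero, Ideal.absNorm_eq_one_iff, Ideal.eq_top_iff_one, hI,
      Ideal.mem_span_pair] at hk'
    obtain ⟨x, y, hxy⟩ := hk'
    obtain ⟨c, hc⟩ := hdvd
    have hβ2 := sq_eq_of_coe_eq hα hβ
    have hc' : (b : 𝓞 K) ^ 2 - d = l * c := by exact_mod_cast congrArg (Int.cast : ℤ → 𝓞 K) hc
    have hmem : (l : 𝓞 K) ∣ b + ((-1 : ℤ) : 𝓞 K) * β := by
      refine ⟨x * (b - β) + c * y, ?_⟩
      push_cast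
      linear_combination -(b - β) * hxy - y * hβ2 + y * hc'
    have := map_dvd (Algebra.norm ℤ) hmem
    rw [hNl, hN] at this
    exact hndvd (by simpa using this)
  · simpa using hk'
  · exfalso
    rw [hk'] at h2
    exact hndvd (by exact_mod_cast h2)

lemma quadratic_span_pair_sq (hd : d < 0) (hα : α ^ 2 = (d : K))
    (hgen : ∀ x : K, ∃ a b : ℚ, x = (a : K) + (b : K) * α) {β : 𝓞 K} (hβ : (β : K) = α)
    {r : ℕ} (hr : r.Prime) {b : ℤ} (hdvd : (r : ℤ) ∣ b ^ 2 - d)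
    (hndvd : ¬ (r : ℤ) ^ 2 ∣ b ^ 2 - d) (hb : (r : ℤ) ∣ 2 * b) :
    Ideal.span {(r : 𝓞 K), (b : 𝓞 K) + β} ^ 2 = Ideal.span {(r : 𝓞 K)} := by
  have hnorm := quadratic_absNorm_span_pair hd hα hgen hβ hr hdvd hndvd
  set I := Ideal.span {(r : 𝓞 K), (b : 𝓞 K) + β} with hI
  have hrI : (r : 𝓞 K) ∈ I := Ideal.subset_span (by simp)
  have hbI : (b : 𝓞 K) + β ∈ I := Ideal.subset_span (by simp)
  have hβ2 := sq_eq_of_coe_eq hα hβ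
  obtain ⟨k, hk⟩ := hb
  obtain ⟨c, hc⟩ := hdvd
  have hrc : ¬ (r : ℤ) ∣ c := by
    rintro ⟨e, rfl⟩
    exact hndvd ⟨e, by rw [hc]; ring⟩
  have hcop : IsCoprime (r : ℤ) c :=
    (Nat.prime_iff_prime_int.1 hr).coprime_iff_not_dvd.2 hrc
  obtain ⟨u, v, huv⟩ := hcop
  have hmem : (r : 𝓞 K) ∈ I ^ 2 := by
    have e1 := Ideal.mul_mem_mul hrI hrI
    have e2 := Ideal.mul_mem_mul hrI hbI
    have e3 := Ideal.mul_mem_mul hbI hbI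
    rw [← sq] at e1 e2 e3
    have : (r : 𝓞 K) = u * (r * r) +
        v * (k * (r * (b + β)) - (b + β) * (b + β)) := by
      have h1 : (u : 𝓞 K) * r + v * c = 1 := by exact_mod_cast congrArg (Int.cast : ℤ → 𝓞 K) huv
      have h2 : (2 : 𝓞 K) * b = r * k := by exact_mod_cast congrArg (Int.cast : ℤ → 𝓞 K) hk
      have h3 : (b : 𝓞 K) ^ 2 - d = r * c := by exact_mod_cast congrArg (Int.cast : ℤ → 𝓞 K) hc
      linear_combination -(r : 𝓞 K) * h1 + v * (b + β) * h2 - v * h3 + v * hβ2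
    rw [this]
    exact Ideal.add_mem _ (Ideal.mul_mem_left _ _ e1)
      (Ideal.mul_mem_left _ _ (Ideal.sub_mem _ (Ideal.mul_mem_left _ _ e2) e3))
  obtain ⟨J, hJ⟩ := Ideal.dvd_iff_le.2 ((Ideal.span_singleton_le_iff_mem _).2 hmem)
  have hN : Ideal.absNorm (Ideal.span {(r : 𝓞 K)}) = r ^ 2 := by
    have h := quadratic_norm_int hd hα hgen hβ r 0
    simp only [Int.cast_natCast, Int.cast_zero, zero_mul, add_zero, ne_eq, OfNat.ofNat_ne_zero,
      not_false_eq_true, zero_pow, mul_zero, sub_zero] at h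
    rw [Ideal.absNorm_span_singleton, h]
    simp [Int.natAbs_pow]
  have hJ1 : Ideal.absNorm J = 1 := by
    have := congrArg Ideal.absNorm hJ
    rw [hN, map_mul, map_pow, hnorm] at this
    exact Nat.eq_of_mul_eq_mul_left (pow_pos hr.pos 2) (by rw [← this, mul_one])
  rw [hJ, Ideal.absNorm_eq_one_iff.1 hJ1, Ideal.mul_top]

lemma norm_natAbs_ne_prime (hd : d < 0) (hα : α ^ 2 = (d : K))
    (hgen : ∀ x : K, ∃ a b : ℚ, x = (a : K) + (b : K) * α) (hsf : Squarefree d)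
    {r : ℕ} (hr : r.Prime) (hrd : 4 * (r : ℤ) < -d) (x : 𝓞 K) :
    (Algebra.norm ℤ x).natAbs ≠ r := by
  intro hx
  obtain ⟨a, b, hab⟩ := hgen x
  have hN : (Algebra.norm ℤ x : ℚ) = a ^ 2 - d * b ^ 2 := by
    rw [Algebra.coe_norm_int, hab, quadratic_norm hd hα hgen]
  have hN1 : (Algebra.norm ℤ (x + 1) : ℚ) = (a + 1) ^ 2 - d * b ^ 2 := by
    rw [Algebra.coe_norm_int, ← quadratic_norm hd hα hgen]
    congr 1
    have : ((x + 1 : 𝓞 K) : K) = (x : K) + 1 := by simp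
    rw [this, hab]
    push_cast
    ring
  have hdq : (d : ℚ) < 0 := by exact_mod_cast hd
  have hpos : 0 ≤ Algebra.norm ℤ x := by
    have : (0 : ℚ) ≤ (Algebra.norm ℤ x : ℚ) := by
      rw [hN]; nlinarith [sq_nonneg a, sq_nonneg b]
    exact_mod_cast this
  have hNr : Algebra.norm ℤ x = r := by omega
  rw [hNr] at hN
  push_cast at hN
  obtain ⟨u, hu⟩ : ∃ u : ℤ, (u : ℚ) = 2 * a :=
    ⟨Algebra.norm ℤ (x + 1) - r - 1, by push_cast; rw [hN1, hN]; ring⟩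
  have hM : ((u ^ 2 - 4 * r : ℤ) : ℚ) = d * (2 * b) ^ 2 := by
    push_cast; rw [hu, hN]; ring
  obtain ⟨w, hw⟩ : ∃ w : ℤ, (w : ℚ) = d * (2 * b) := by
    have hsq : IsSquare (((u ^ 2 - 4 * r) * d : ℤ) : ℚ) := by
      refine ⟨d * (2 * b), ?_⟩
      rw [Int.cast_mul, hM]; ring
    rw [Rat.isSquare_intCast_iff] at hsq
    obtain ⟨w, hw⟩ := hsq
    have : (w : ℚ) ^ 2 = (d * (2 * b)) ^ 2 := by
      have : (((u ^ 2 - 4 * r) * d : ℤ) : ℚ) = w * w := by rw [hw]; push_cast; ring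
      rw [Int.cast_mul, hM] at this
      rw [sq (w : ℚ), ← this]; ring
    rcases sq_eq_sq_iff_eq_or_eq_neg.1 this with h | h
    · exact ⟨w, h⟩
    · exact ⟨-w, by push_cast; rw [h]; ring⟩
  have hw2 : w ^ 2 = d * (u ^ 2 - 4 * r) := by
    have : ((w ^ 2 : ℤ) : ℚ) = ((d * (u ^ 2 - 4 * r) : ℤ) : ℚ) := by
      rw [Int.cast_mul, hM, Int.cast_pow, hw]; ring
    exact_mod_cast this
  obtain ⟨v, rfl⟩ : d ∣ w := (hsf.dvd_pow_iff_dvd two_ne_zero).1 ⟨_, hw2⟩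
  have huv : u ^ 2 = 4 * r + d * v ^ 2 := by
    have : d * (d * v ^ 2) = d * (u ^ 2 - 4 * r) := by rw [← hw2]; ring
    have := mul_left_cancel₀ hd.ne this
    omega
  have hv : v = 0 := by
    by_contra hv
    have : 0 < v ^ 2 := by positivity
    nlinarith [sq_nonneg u]
  subst hv
  have hu2 : u ^ 2 = 4 * r := by simpa using huv
  have hprime := Nat.prime_iff_prime_int.1 hr
  obtain ⟨e, rfl⟩ : (2 : ℤ) ∣ u :=
    Int.prime_two.dvd_of_dvd_pow (n := 2) ⟨2 * r, by rw [hu2]; ring⟩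
  have : (r : ℤ) = e ^ 2 := by linarith
  exact hprime.not_isSquare ⟨e, by rw [this]; ring⟩

end QuadraticField

section GenusCharacters

open NumberField nonZeroDivisors

/-- The rationals of the form `(x ^ 2 - d * y ^ 2) * m` with `m` a quadratic residue prime to `p`;
they are norms from `ℚ_p(√d)`. -/
def localNormSubgroup (d : ℤ) (p : ℕ) [Fact p.Prime] : Subgroup ℚˣ where
  carrier := {N | ∃ x y : ℚ, ∃ m : ℤ, legendreSym p m = 1 ∧ (N : ℚ) = (x ^ 2 - d * y ^ 2) * m}
  one_mem' := ⟨1, 0, 1, legendreSym.at_one p, by simp⟩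
  mul_mem' := by
    rintro M N ⟨x, y, m, hm, hM⟩ ⟨z, w, k, hk, hN⟩
    refine ⟨x * z + d * y * w, x * w + y * z, m * k, ?_, ?_⟩
    · rw [legendreSym.mul, hm, hk, one_mul]
    · rw [Units.val_mul, hM, hN]
      push_cast
      ring
  inv_mem' := by
    rintro N ⟨x, y, m, hm, hN⟩
    refine ⟨x / N, y / N, m, hm, ?_⟩
    have hN0 : (N : ℚ) ≠ 0 := N.ne_zero
    rw [Units.val_inv_eq_inv_val]
    field_simp
    exact hN

lemma eq_zero_of_mul_sq_eq {d : ℤ} {p : ℕ} [Fact p.Prime] (hpd : (p : ℤ) ∣ d)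
    (hpd2 : ¬ (p : ℤ) ^ 2 ∣ d) {m k : ℤ} (hm : legendreSym p m = -1) (hk : legendreSym p k = 1) :
    ∀ (n : ℕ) (x y z : ℤ), z.natAbs = n → m * z ^ 2 = (x ^ 2 - d * y ^ 2) * k → z = 0 := by
  have hp : Prime (p : ℤ) := Nat.prime_iff_prime_int.1 Fact.out
  have hpk : ¬ (p : ℤ) ∣ k := by
    intro h
    rw [(legendreSym.eq_zero_iff p k).2 ((ZMod.intCast_zmod_eq_zero_iff_dvd k p).2 h)] at hk
    exact zero_ne_one hk
  obtain ⟨e, rfl⟩ := hpd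
  have hpe : ¬ (p : ℤ) ∣ e := fun ⟨c, hc⟩ => hpd2 ⟨c, by rw [hc]; ring⟩
  intro n
  induction n using Nat.strong_induction_on with
  | _ n ih =>
  intro x y z hzn h
  by_contra hz0
  by_cases hpz : (p : ℤ) ∣ z
  · obtain ⟨z, rfl⟩ := hpz
    have hx : (p : ℤ) ∣ x := by
      have : (p : ℤ) ∣ x ^ 2 * k :=
        ⟨m * p * z ^ 2 + e * y ^ 2 * k, by linear_combination -h⟩
      exact hp.dvd_of_dvd_pow ((hp.dvd_or_dvd this).resolve_right hpk)
    obtain ⟨x, rfl⟩ := hx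
    have hy : (p : ℤ) ∣ y := by
      have : (p : ℤ) ∣ e * k * y ^ 2 := by
        refine ⟨x ^ 2 * k - m * z ^ 2, mul_left_cancel₀ hp.ne_zero ?_⟩
        linear_combination h
      rcases hp.dvd_or_dvd this with h | h
      · exact absurd h (fun h => (hp.dvd_or_dvd h).elim hpe hpk)
      · exact hp.dvd_of_dvd_pow h
    obtain ⟨y, rfl⟩ := hy
    have hz : z ≠ 0 := right_ne_zero_of_mul hz0
    refine hz (ih z.natAbs ?_ x y z rfl ?_)
    · rw [← hzn, Int.natAbs_mul, Int.natAbs_natCast]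
      have := (Fact.out : p.Prime).one_lt
      have : 0 < z.natAbs := Int.natAbs_pos.2 hz
      nlinarith
    · refine mul_left_cancel₀ (pow_ne_zero 2 hp.ne_zero) ?_
      linear_combination h
  · have hz : (z : ZMod p) ≠ 0 := fun h => hpz ((ZMod.intCast_zmod_eq_zero_iff_dvd z p).1 h)
    have h1 : legendreSym p (m * z ^ 2) = -1 := by
      rw [legendreSym.mul, hm, legendreSym.sq_one' p hz, mul_one]
    have h2 : legendreSym p ((x ^ 2 - p * e * y ^ 2) * k) = legendreSym p x ^ 2 := by
      have : legendreSym p ((x ^ 2 - p * e * y ^ 2) * k) = legendreSym p (x * x * k) := by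
        simp only [legendreSym]
        congr 1
        push_cast
        simp [sq]
      rw [this, legendreSym.mul, legendreSym.mul, hk, mul_one, sq]
    rw [h, h2] at h1
    nlinarith [sq_nonneg (legendreSym p x)]

lemma notMem_localNormSubgroup {d : ℤ} {p : ℕ} [Fact p.Prime] (hpd : (p : ℤ) ∣ d)
    (hpd2 : ¬ (p : ℤ) ^ 2 ∣ d) {m : ℤ} (hm : legendreSym p m = -1) {N : ℚˣ} (hN : (N : ℚ) = m) :
    N ∉ localNormSubgroup d p := by
  rintro ⟨x, y, k, hk, h⟩
  rw [hN] at h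
  have hx := x.num_div_den
  have hy := y.num_div_den
  have hx0 : (x.den : ℚ) ≠ 0 := by exact_mod_cast x.den_ne_zero
  have hy0 : (y.den : ℚ) ≠ 0 := by exact_mod_cast y.den_ne_zero
  have key := eq_zero_of_mul_sq_eq hpd hpd2 hm hk _ (x.num * y.den) (y.num * x.den)
    (x.den * y.den) rfl (by
      have : (m : ℚ) * (x.den * y.den) ^ 2 =
          ((x.num * y.den) ^ 2 - d * (y.num * x.den) ^ 2) * k := by
        rw [h]
        nth_rewrite 1 [← hx, ← hy]
        field_simp
      exact_mod_cast this)
  have : (x.den * y.den : ℤ) ≠ 0 := by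
    exact_mod_cast mul_ne_zero x.den_ne_zero y.den_ne_zero
  exact this key

variable {K : Type} [Field K] [NumberField K]

lemma exists_classGroup_norm_hom (H : Subgroup ℚˣ)
    (hH : ∀ (x : K) (N : ℚˣ), (N : ℚ) = |Algebra.norm ℚ x| → N ∈ H) :
    ∃ f : ClassGroup (𝓞 K) →* ℚˣ ⧸ H, ∀ (I : (Ideal (𝓞 K))⁰) (N : ℚˣ),
      (N : ℚ) = Ideal.absNorm (I : Ideal (𝓞 K)) → f (ClassGroup.mk0 I) = N := by
  let ψ : (FractionalIdeal (𝓞 K)⁰ K)ˣ →* ℚˣ :=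
    Units.map (FractionalIdeal.absNorm : FractionalIdeal (𝓞 K)⁰ K →*₀ ℚ)
  have hψ : ∀ I, (ψ I : ℚ) = FractionalIdeal.absNorm (I : FractionalIdeal (𝓞 K)⁰ K) :=
    fun _ => rfl
  have hφ : (toPrincipalIdeal (𝓞 K) K).range ≤ H.comap ψ := by
    rintro _ ⟨x, rfl⟩
    refine hH x _ ?_
    rw [hψ, coe_toPrincipalIdeal, FractionalIdeal.absNorm_span_singleton]
  refine ⟨(QuotientGroup.map _ H ψ hφ).comp (ClassGroup.equiv (R := 𝓞 K) K).toMonoidHom,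
    fun I N hN => ?_⟩
  rw [MonoidHom.comp_apply, MulEquiv.toMonoidHom_eq_coe, MonoidHom.coe_coe, ClassGroup.equiv_mk0,
    QuotientGroup.mk'_apply, QuotientGroup.map_mk]
  congr 1
  ext
  rw [hψ, hN, FractionalIdeal.coe_mk0, FractionalIdeal.coeIdeal_absNorm]

lemma two_pow_succ_dvd_card {G H : Type*} [CommGroup G] [Finite G] [CommGroup H] (f : G →* H)
    (hH : ∀ h : H, h ^ 2 = 1) {t : ℕ} (ht : 2 ^ t ≤ Nat.card f.range)
    {g : G} (hg : g ≠ 1) (hg2 : g ^ 2 = 1) (hfg : f g = 1) : 2 ^ (t + 1) ∣ Nat.card G := by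
  have hcard : Nat.card G = Nat.card f.range * Nat.card f.ker := by
    rw [Subgroup.card_eq_card_quotient_mul_card_subgroup f.ker,
      Nat.card_congr (QuotientGroup.quotientKerEquivRange f).toEquiv]
  have hker : 2 ∣ Nat.card f.ker := by
    have h2 : orderOf (⟨g, hfg⟩ : f.ker) = 2 :=
      orderOf_eq_prime (Subtype.ext hg2) (fun h => hg (congrArg Subtype.val h))
    rw [← h2]
    exact orderOf_dvd_natCard _
  have : Finite f.range := Set.finite_range f
  have hpg : IsPGroup 2 f.range := fun x => ⟨1, Subtype.ext (by simpa using hH x)⟩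
  obtain ⟨k, hk⟩ := IsPGroup.iff_card.1 hpg
  rw [hk] at ht
  rw [hcard, hk, pow_succ]
  exact mul_dvd_mul (pow_dvd_pow 2 ((Nat.pow_le_pow_iff_right one_lt_two).1 ht)) hker

theorem two_pow_succ_dvd_classNumber {d : ℤ} {α : K} (hd : d < 0) (hα : α ^ 2 = (d : K))
    (hgen : ∀ x : K, ∃ a b : ℚ, x = (a : K) + (b : K) * α) (hsf : Squarefree d)
    {t : ℕ} (p : Fin t → ℕ) [∀ i, Fact (p i).Prime] (hpd : ∀ i, (p i : ℤ) ∣ d)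
    (hprimes : ∀ ε : Fin t → ℤˣ, ∃ l : ℕ, l.Prime ∧
      (∃ b : ℤ, (l : ℤ) ∣ b ^ 2 - d ∧ ¬ (l : ℤ) ^ 2 ∣ b ^ 2 - d) ∧
      ∀ i, legendreSym (p i) l = ε i)
    {r : ℕ} (hr : r.Prime) (hrd : 4 * (r : ℤ) < -d) {b : ℤ} (hdvd : (r : ℤ) ∣ b ^ 2 - d)
    (hndvd : ¬ (r : ℤ) ^ 2 ∣ b ^ 2 - d) (hb : (r : ℤ) ∣ 2 * b)
    (hrp : ∀ i, legendreSym (p i) r = 1) :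
    2 ^ (t + 1) ∣ classNumber K := by
  obtain ⟨β, hβ⟩ := exists_ringOfIntegers_sq_eq hα
  have hpd2 : ∀ i, ¬ (p i : ℤ) ^ 2 ∣ d := by
    intro i h
    rw [sq] at h
    exact (Nat.prime_iff_prime_int.1 (Fact.out : (p i).Prime)).not_isUnit (hsf _ h)
  have hideal : ∀ {l : ℕ}, l.Prime → ∀ {c : ℤ}, (l : ℤ) ∣ c ^ 2 - d → ¬ (l : ℤ) ^ 2 ∣ c ^ 2 - d →
      ∃ I : (Ideal (𝓞 K))⁰, (I : Ideal (𝓞 K)) = Ideal.span {(l : 𝓞 K), (c : 𝓞 K) + β} ∧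
        Ideal.absNorm (I : Ideal (𝓞 K)) = l := by
    intro l hl c h1 h2
    have h := quadratic_absNorm_span_pair hd hα hgen hβ hl h1 h2
    refine ⟨⟨_, mem_nonZeroDivisors_of_ne_zero fun h0 => hl.ne_zero ?_⟩, rfl, h⟩
    exact h.symm.trans ((congrArg Ideal.absNorm h0).trans Ideal.absNorm_bot)
  have hf : ∀ i, ∃ f : ClassGroup (𝓞 K) →* ℚˣ ⧸ localNormSubgroup d (p i),
      ∀ (I : (Ideal (𝓞 K))⁰) (N : ℚˣ),
        (N : ℚ) = Ideal.absNorm (I : Ideal (𝓞 K)) → f (ClassGroup.mk0 I) = N := by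
    refine fun i => exists_classGroup_norm_hom _ fun x N hN => ?_
    obtain ⟨u, v, rfl⟩ := hgen x
    refine ⟨u, v, 1, legendreSym.at_one _, ?_⟩
    have hd' : (d : ℚ) < 0 := by exact_mod_cast hd
    rw [hN, quadratic_norm hd hα hgen, Int.cast_one, mul_one, abs_of_nonneg]
    nlinarith [sq_nonneg u, sq_nonneg v]
  choose f hf using hf
  let F : ClassGroup (𝓞 K) →* ∀ i, ℚˣ ⧸ localNormSubgroup d (p i) := MonoidHom.pi f
  have hexp : ∀ h : (∀ i, ℚˣ ⧸ localNormSubgroup d (p i)), h ^ 2 = 1 := by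
    intro h
    funext i
    obtain ⟨N, hN⟩ := QuotientGroup.mk_surjective (h i)
    rw [Pi.pow_apply, ← hN, Pi.one_apply, ← QuotientGroup.mk_pow, QuotientGroup.eq_one_iff]
    exact ⟨N, 0, 1, legendreSym.at_one _, by simp⟩
  choose l hl c hlε using hprimes
  choose c hc1 hc2 using c
  choose J hJ hJN using fun ε => hideal (hl ε) (hc1 ε) (hc2 ε)
  have hinj : Function.Injective fun ε => (⟨F (ClassGroup.mk0 (J ε)), _, rfl⟩ : F.range) := by
    intro ε δ h
    by_contra hne
    obtain ⟨i, hi⟩ := Function.ne_iff.1 hne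
    have hεi := congrFun (congrArg Subtype.val h) i
    have hu : ∀ ε, (l ε : ℚ) ≠ 0 := fun ε => by exact_mod_cast (hl ε).ne_zero
    change f i _ = f i _ at hεi
    rw [hf i _ (Units.mk0 _ (hu ε)) (by rw [hJN]; rfl),
      hf i _ (Units.mk0 _ (hu δ)) (by rw [hJN]; rfl), QuotientGroup.eq] at hεi
    have hsq : (Units.mk0 _ (hu ε)) ^ 2 ∈ localNormSubgroup d (p i) :=
      ⟨l ε, 0, 1, legendreSym.at_one _, by simp⟩
    have hmem := mul_mem hsq hεi
    refine notMem_localNormSubgroup (hpd i) (hpd2 i) (m := l ε * l δ) ?_ ?_ hmem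
    · rw [legendreSym.mul, hlε, hlε]
      rcases Int.units_eq_one_or (ε i) with h1 | h1 <;>
        rcases Int.units_eq_one_or (δ i) with h2 | h2 <;> simp_all
    · have := hu ε
      push_cast
      simp [field]
  have hrange : 2 ^ t ≤ Nat.card F.range := by
    have : Finite F.range := Set.finite_range F
    have := Nat.card_le_card_of_injective _ hinj
    simpa using this
  obtain ⟨I, hI, hIN⟩ := hideal hr hdvd hndvd
  have hmain := two_pow_succ_dvd_card F hexp hrange (g := ClassGroup.mk0 I) ?_ ?_ ?_
  · rwa [classNumber, ← Nat.card_eq_fintype_card]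
  · rw [Ne, ClassGroup.mk0_eq_one_iff]
    rintro ⟨x, hx⟩
    refine norm_natAbs_ne_prime hd hα hgen hsf hr hrd x ?_
    rw [← hIN, hx, ← Ideal.absNorm_span_singleton]
  · rw [← map_pow, ClassGroup.mk0_eq_one_iff, SubmonoidClass.coe_pow, hI,
      quadratic_span_pair_sq hd hα hgen hβ hr hdvd hndvd hb]
    exact ⟨_, rfl⟩
  · funext i
    have hu : (r : ℚ) ≠ 0 := by exact_mod_cast hr.ne_zero
    change f i _ = 1
    rw [hf i _ (Units.mk0 _ hu) (by rw [hIN]; rfl), QuotientGroup.eq_one_iff]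
    exact ⟨1, 0, r, hrp i, by simp⟩

end GenusCharacters

section PrimesWithPrescribedSymbols

lemma legendreSym_eq_of_modEq {p : ℕ} [Fact p.Prime] {a b : ℕ} (h : a ≡ b [MOD p]) :
    legendreSym p a = legendreSym p b := by
  have : ((a : ℕ) : ZMod p) = b := (ZMod.natCast_eq_natCast_iff _ _ _).2 h
  simp [legendreSym, this]

lemma exists_nat_legendreSym_eq {p : ℕ} [Fact p.Prime] (hp2 : p ≠ 2) (ε : ℤˣ) :
    ∃ a : ℕ, legendreSym p a = ε := by
  rcases Int.units_eq_one_or ε with rfl | rfl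
  · exact ⟨1, by simp⟩
  · obtain ⟨a, ha⟩ := quadraticChar_exists_neg_one (F := ZMod p) (by rwa [ZMod.ringChar_zmod_n])
    exact ⟨a.val, by simpa [legendreSym] using ha⟩

lemma exists_prime_gt_legendreSym_eq {ι : Type*} [Fintype ι] (p : ι → ℕ)
    [∀ i, Fact (p i).Prime] (hinj : Function.Injective p) (hp2 : ∀ i, p i ≠ 2) (ε : ι → ℤˣ)
    {m c : ℕ} (hm : m ≠ 0) (hcm : c.Coprime m) (hpm : ∀ i, (p i).Coprime m) (N : ℕ) :
    ∃ l > N, l.Prime ∧ l ≡ c [MOD m] ∧ ∀ i, legendreSym (p i) l = ε i := by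
  choose a ha using fun i => exists_nat_legendreSym_eq (hp2 i) (ε i)
  obtain ⟨k, hk⟩ := Nat.chineseRemainderOfFinset a p Finset.univ
    (fun i _ => (Fact.out : (p i).Prime).ne_zero)
    (fun i _ j _ hij => (Nat.coprime_primes Fact.out Fact.out).2 (hinj.ne hij))
  have hcop : (∏ i, p i).Coprime m := Nat.Coprime.prod_left fun i _ => hpm i
  obtain ⟨x, hxk, hxc⟩ := Nat.chineseRemainder hcop k c
  have hxi : ∀ i, x ≡ a i [MOD p i] := fun i =>
    (hxk.of_dvd (Finset.dvd_prod_of_mem p (Finset.mem_univ i))).trans (hk i (Finset.mem_univ i))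
  have hx : x.Coprime ((∏ i, p i) * m) := by
    refine Nat.Coprime.mul_right (Nat.Coprime.prod_right fun i _ => ?_) ?_
    · refine ((Fact.out : (p i).Prime).coprime_iff_not_dvd.2 fun h => ?_).symm
      have h0 : legendreSym (p i) x = 0 := by
        rw [legendreSym.eq_zero_iff]
        exact_mod_cast (ZMod.natCast_eq_zero_iff x (p i)).2 h
      rw [legendreSym_eq_of_modEq (hxi i), ha] at h0
      exact (ε i).ne_zero h0
    · rw [Nat.Coprime, hxc.gcd_eq]
      exact hcm
  have hne : (∏ i, p i) * m ≠ 0 :=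
    mul_ne_zero (Finset.prod_ne_zero_iff.2 fun i _ => (Fact.out : (p i).Prime).ne_zero) hm
  obtain ⟨l, hlN, hl, hlx⟩ := Nat.forall_exists_prime_gt_and_modEq N hne hx
  refine ⟨l, hlN, hl, (hlx.of_dvd (dvd_mul_left _ _)).trans hxc, fun i => ?_⟩
  rw [← ha i]
  refine legendreSym_eq_of_modEq (Nat.ModEq.trans (hlx.of_dvd ?_) (hxi i))
  exact (Finset.dvd_prod_of_mem p (Finset.mem_univ i)).mul_right m

lemma exists_dvd_sq_sub_not_sq_dvd {l : ℕ} [Fact l.Prime] (hl2 : l ≠ 2) {d : ℤ}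
    (h : legendreSym l d = 1) : ∃ b : ℤ, (l : ℤ) ∣ b ^ 2 - d ∧ ¬ (l : ℤ) ^ 2 ∣ b ^ 2 - d := by
  have hl : Prime (l : ℤ) := Nat.prime_iff_prime_int.1 Fact.out
  have hd0 : (d : ZMod l) ≠ 0 := by
    intro h0
    rw [(legendreSym.eq_zero_iff l d).2 h0] at h
    exact zero_ne_one h
  obtain ⟨y, hy⟩ := (legendreSym.eq_one_iff l hd0).1 h
  obtain ⟨b, rfl⟩ := ZMod.intCast_surjective y
  have hb : (l : ℤ) ∣ b ^ 2 - d := by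
    rw [← ZMod.intCast_zmod_eq_zero_iff_dvd]
    push_cast
    rw [hy]
    ring
  have hlb : ¬ (l : ℤ) ∣ b := by
    intro hlb
    rw [(ZMod.intCast_zmod_eq_zero_iff_dvd b l).2 hlb, mul_zero] at hy
    exact hd0 hy
  by_cases hb2 : (l : ℤ) ^ 2 ∣ b ^ 2 - d
  · refine ⟨b + l, ?_, fun h2 => ?_⟩
    · have : (b + l) ^ 2 - d = (b ^ 2 - d) + l * (2 * b + l) := by ring
      rw [this]
      exact dvd_add hb (dvd_mul_right _ _)
    · have h3 : (l : ℤ) ^ 2 ∣ l * (2 * b) := by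
        have : (l : ℤ) * (2 * b) = ((b + l) ^ 2 - d) - (b ^ 2 - d) - l ^ 2 := by ring
        rw [this]
        exact dvd_sub (dvd_sub h2 hb2) dvd_rfl
      rw [sq] at h3
      rcases hl.dvd_or_dvd ((mul_dvd_mul_iff_left hl.ne_zero).1 h3) with h4 | h4
      · exact hl2 ((Nat.prime_dvd_prime_iff_eq Fact.out Nat.prime_two).1 (by exact_mod_cast h4))
      · exact hlb h4
  · exact ⟨b, hb, hb2⟩

lemma legendreSym_prod {l : ℕ} [Fact l.Prime] {ι : Type*} (s : Finset ι) (p : ι → ℕ) :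
    legendreSym l ((∏ i ∈ s, p i : ℕ) : ℤ) = ∏ i ∈ s, legendreSym l (p i) := by
  rw [Nat.cast_prod]
  exact map_prod (legendreSym.hom l) _ s

lemma legendreSym_neg_prod {l : ℕ} [Fact l.Prime] (hl2 : l ≠ 2) {t : ℕ} (p : Fin t → ℕ)
    [∀ i, Fact (p i).Prime] (hp : ∀ i, p i % 4 = 1) :
    legendreSym l (-((∏ i, p i : ℕ) : ℤ)) = ZMod.χ₄ l * ∏ i, legendreSym (p i) l := by
  rw [legendreSym.at_neg hl2, legendreSym_prod]
  congr 1
  exact Finset.prod_congr rfl fun i _ =>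
    legendreSym.quadratic_reciprocity_one_mod_four (hp i) hl2

lemma exists_prime_legendreSym_neg_prod {t : ℕ} (p : Fin t → ℕ)
    [∀ i, Fact (p i).Prime] (hinj : Function.Injective p) (hp : ∀ i, p i % 4 = 1)
    (ε : Fin t → ℤˣ) :
    ∃ l : ℕ, l.Prime ∧ (∃ b : ℤ, (l : ℤ) ∣ b ^ 2 - -((∏ i, p i : ℕ) : ℤ) ∧
      ¬ (l : ℤ) ^ 2 ∣ b ^ 2 - -((∏ i, p i : ℕ) : ℤ)) ∧ ∀ i, legendreSym (p i) l = ε i := by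
  have hp2 : ∀ i, p i ≠ 2 := fun i h => by
    have := hp i
    omega
  have hp4 : ∀ i, (p i).Coprime 4 := fun i =>
    ((Nat.coprime_primes Fact.out Nat.prime_two).2 (hp2 i)).pow_right 2
  obtain ⟨c, hc4, hc⟩ : ∃ c : ℕ, c.Coprime 4 ∧
      ∀ l : ℕ, l ≡ c [MOD 4] → ZMod.χ₄ l * ((∏ i, ε i : ℤˣ) : ℤ) = 1 := by
    rcases Int.units_eq_one_or (∏ i, ε i) with h | h <;> rw [h]
    · exact ⟨1, by decide, fun l hl => by rw [ZMod.χ₄_nat_one_mod_four hl]; rfl⟩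
    · exact ⟨3, by decide, fun l hl => by rw [ZMod.χ₄_nat_three_mod_four hl]; rfl⟩
  obtain ⟨l, hl2, hl, hlc, hlε⟩ := exists_prime_gt_legendreSym_eq p hinj hp2 ε
    four_ne_zero hc4 hp4 2
  have : Fact l.Prime := ⟨hl⟩
  refine ⟨l, hl, exists_dvd_sq_sub_not_sq_dvd hl2.ne' ?_, hlε⟩
  rw [legendreSym_neg_prod hl2.ne' p hp, ← hc l hlc]
  simp [hlε]

lemma exists_prime_legendreSym_neg_prod_mul {t : ℕ} (p : Fin t → ℕ)
    [∀ i, Fact (p i).Prime] (hinj : Function.Injective p) (hp : ∀ i, p i % 4 = 1)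
    {q : ℕ} [Fact q.Prime] (hq2 : q ≠ 2) (hqp : ∀ i, q ≠ p i) (ε : Fin t → ℤˣ) :
    ∃ l : ℕ, l.Prime ∧ (∃ b : ℤ, (l : ℤ) ∣ b ^ 2 - -(((∏ i, p i) * q : ℕ) : ℤ) ∧
      ¬ (l : ℤ) ^ 2 ∣ b ^ 2 - -(((∏ i, p i) * q : ℕ) : ℤ)) ∧
      ∀ i, legendreSym (p i) l = ε i := by
  let P : Option (Fin t) → ℕ := fun o => o.elim q p
  have hP : ∀ o, Fact (P o).Prime := by
    rintro (_ | i)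
    · exact ‹Fact q.Prime›
    · exact ‹∀ i, Fact (p i).Prime› i
  have hPinj : Function.Injective P := by
    rintro (_ | i) (_ | j) h
    · rfl
    · exact absurd h (hqp j)
    · exact absurd h.symm (hqp i)
    · exact congrArg some (hinj h)
  have hP2 : ∀ o, P o ≠ 2 := by
    rintro (_ | i) h
    · exact hq2 h
    · have := hp i
      change p i = 2 at h
      omega
  have hP4 : ∀ o, (P o).Coprime 4 := fun o =>
    ((Nat.coprime_primes Fact.out Nat.prime_two).2 (hP2 o)).pow_right 2
  obtain ⟨l, hl2, hl, hlc, hlε⟩ := exists_prime_gt_legendreSym_eq P hPinj hP2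
    (fun o => o.elim (∏ i, ε i) ε) four_ne_zero (Nat.coprime_one_left 4) hP4 2
  have : Fact l.Prime := ⟨hl⟩
  have hlp : ∀ i, legendreSym (p i) l = ε i := fun i => hlε (some i)
  have hlq : legendreSym q l = ((∏ i, ε i : ℤˣ) : ℤ) := hlε none
  refine ⟨l, hl, exists_dvd_sq_sub_not_sq_dvd hl2.ne' ?_, hlp⟩
  rw [Nat.cast_mul, ← neg_mul, legendreSym.mul, legendreSym_neg_prod hl2.ne' p hp,
    ZMod.χ₄_nat_one_mod_four hlc, ← legendreSym.quadratic_reciprocity_one_mod_four hlc hq2, hlq,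
    Finset.prod_congr rfl fun i _ => hlp i, one_mul, Units.coe_prod, ← Finset.prod_mul_distrib]
  refine Finset.prod_eq_one fun i _ => ?_
  rw [← Units.val_mul, Int.units_mul_self, Units.val_one]

end PrimesWithPrescribedSymbols

lemma squarefree_prod_primes {t : ℕ} {p : Fin t → ℕ} (hp : ∀ i, (p i).Prime)
    (hinj : Function.Injective p) : Squarefree (∏ i, p i) :=
  Finset.squarefree_prod_of_pairwise_isCoprime
    (fun _ _ _ _ hij => Nat.coprime_iff_isRelPrime.1
      ((Nat.coprime_primes (hp _) (hp _)).2 (hinj.ne hij)))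
    fun i _ => (hp i).squarefree

theorem stmt5 (t : ℕ) (ht : 1 ≤ t) (p : Fin t → ℕ) (q : ℕ)
    (hp : ∀ i, (p i).Prime) (hpmod : ∀ i, p i % 8 = 1) (hinj : Function.Injective p)
    (hq : q.Prime) (hqmod : q % 8 = 3) (hqp : ∀ i, q ≠ p i)
    (nq n : ℕ) (hnq : nq = ∏ i, p i) (hn : n = nq * q)
    (hQR : ∀ i, IsSquare ((q : ZMod (p i))))
    (hrank : (AMatrix t p).rank = t - 1)
    (K K' : Type) [Field K] [NumberField K] [Field K'] [NumberField K']
    (hK : IsQuadSqrtField K (-(n : ℤ))) (hK' : IsQuadSqrtField K' (-(nq : ℤ))) :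
    2 ^ (t + 1) ∣ NumberField.classNumber K ∧ 2 ^ (t + 1) ∣ NumberField.classNumber K' := by
  have hfact : ∀ i, Fact (p i).Prime := fun i => ⟨hp i⟩
  have hfactq : Fact q.Prime := ⟨hq⟩
  obtain ⟨α, hα, hgen⟩ := hK
  obtain ⟨α', hα', hgen'⟩ := hK'
  have hp4 : ∀ i, p i % 4 = 1 := fun i => by have := hpmod i; omega
  have hnq8 : nq % 8 = 1 := by
    rw [hnq, Finset.prod_nat_mod, Finset.prod_congr rfl fun i _ => hpmod i]
    simp
  have hdvd : ∀ i, p i ∣ nq := fun i => hnq ▸ Finset.dvd_prod_of_mem p (Finset.mem_univ i)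
  have hnq9 : 9 ≤ nq := by
    have h0 : nq ≠ 1 := fun h => (hp ⟨0, ht⟩).one_lt.ne' (Nat.dvd_one.1 (h ▸ hdvd ⟨0, ht⟩))
    omega
  have hsq : Squarefree nq := hnq ▸ squarefree_prod_primes hp hinj
  have hqnq : q.Coprime nq := by
    rw [hnq]
    exact Nat.Coprime.prod_right fun i _ => (Nat.coprime_primes hq (hp i)).2 (hqp i)
  have hsn : Squarefree n := by
    rw [hn]
    exact (Nat.squarefree_mul hqnq.symm).2 ⟨hsq, hq.squarefree⟩
  have hnpos : 4 * q < n := by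
    rw [hn]
    nlinarith [hq.pos]
  constructor
  · refine two_pow_succ_dvd_classNumber (d := -(n : ℤ)) (by omega) hα hgen
      (Int.squarefree_natAbs.1 (by simpa using hsn)) p (fun i => ?_) ?_ hq (b := 0) (by omega)
      ?_ ?_ (by simp) fun i => ?_
    · rw [dvd_neg, hn]
      exact_mod_cast (hdvd i).mul_right q
    · subst hn hnq
      exact exists_prime_legendreSym_neg_prod_mul p hinj hp4 (by omega) hqp
    · refine ⟨nq, ?_⟩
      rw [hn]
      push_cast
      ring
    · intro h
      have h1 : q ^ 2 ∣ n := by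
        have : (q : ℤ) ^ 2 ∣ (n : ℤ) := by simpa using h
        exact_mod_cast this
      rw [sq] at h1
      exact hq.not_isUnit (hsn _ h1)
    · rw [legendreSym.eq_one_iff']
      · exact hQR i
      · rw [Ne, ZMod.natCast_eq_zero_iff, Nat.prime_dvd_prime_iff_eq (hp i) hq]
        exact (hqp i).symm
  · refine two_pow_succ_dvd_classNumber (d := -(nq : ℤ)) (by omega) hα' hgen'
      (Int.squarefree_natAbs.1 (by simpa using hsq)) p (fun i => ?_) ?_ Nat.prime_two (b := 1)
      (by push_cast; omega) (by push_cast; omega) (by push_cast; omega) (by simp) fun i => ?_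
    · rw [dvd_neg]
      exact_mod_cast hdvd i
    · subst hnq
      exact exists_prime_legendreSym_neg_prod p hinj hp4
    · have h8 := hpmod i
      have h2 : p i ≠ 2 := fun h => by omega
      rw [Nat.cast_ofNat, legendreSym.at_two h2, ZMod.χ₈_nat_mod_eight, h8]
      rfl
end

section
/- Let q be a prime with q ≡ 3 (mod 8), and let n_q be a squarefree positive integer all of whose prime factors are congruent to 1 modulo 8, such that q is a quadratic residue modulo every prime factor of n_q. Suppose x, y, z, w are pairwise coprime integers with x, z, w odd and positive and y even and nonzero, satisfying x² + q·y² = n_q·z² and x² − q·y² = w². Then x ≡ 1 (mod 4) if and only if the number of primes p dividing n_q for which q is not a quartic residue modulo p is even. -/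
/-- If `-1` is a fourth power in a field and `x² + q y² = 0`, then `q` is a fourth power exactly
when `x y` is a square. -/
theorem exists_pow_four_eq_iff_isSquare_mul {F : Type*} [Field F] {ζ q x y : F} (hζ : ζ ^ 4 = -1)
    (hy : y ≠ 0) (h : x ^ 2 + q * y ^ 2 = 0) : (∃ s : F, s ^ 4 = q) ↔ IsSquare (x * y) := by
  constructor
  · rintro ⟨s, rfl⟩
    have hfac : (x - (ζ * s) ^ 2 * y) * (x + (ζ * s) ^ 2 * y) = 0 := by
      linear_combination h - s ^ 4 * y ^ 2 * hζ
    rcases mul_eq_zero.mp hfac with h1 | h1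
    · exact ⟨ζ * s * y, by linear_combination y * h1⟩
    · exact ⟨ζ ^ 2 * (ζ * s * y), by
        linear_combination y * h1 - (ζ * s * y) ^ 2 * hζ⟩
  · rintro ⟨u, hu⟩
    refine ⟨ζ * u / y, ?_⟩
    field_simp
    have hxy : u ^ 4 = -(q * y ^ 4) := by
      linear_combination y ^ 2 * h - (x * y + u * u) * hu
    rw [hζ, hxy]
    ring

theorem ZMod.exists_pow_four_eq_neg_one {p : ℕ} [Fact p.Prime] (hp : p % 8 = 1) :
    ∃ ζ : ZMod p, ζ ^ 4 = -1 := by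
  have hp2 : p ≠ 2 := by omega
  obtain ⟨t, ht⟩ := (ZMod.exists_sq_eq_two_iff hp2).mpr (Or.inl hp)
  obtain ⟨i, hi⟩ := (ZMod.exists_sq_eq_neg_one_iff (p := p)).mpr (by omega)
  have h2 : (2 : ZMod p) ≠ 0 := by
    intro h
    have : (p : ℕ) ∣ 2 := (ZMod.natCast_eq_zero_iff 2 p).mp (by exact_mod_cast h)
    exact hp2 ((Nat.prime_dvd_prime_iff_eq Fact.out Nat.prime_two).mp this)
  have ht0 : t ≠ 0 := by
    rintro rfl
    exact h2 (by simpa using ht)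
  refine ⟨(1 + i) / t, ?_⟩
  rw [div_pow, div_eq_iff (pow_ne_zero 4 ht0)]
  linear_combination (-(i ^ 2) - 4 * i - 5) * hi + (-(2 : ZMod p) - t * t) * ht

open scoped Classical in
/-- The Jacobi symbol of a squarefree modulus counts the primes at which it is `-1`. -/
theorem jacobiSym_eq_neg_one_pow_card {a : ℤ} {n : ℕ} (hn : Squarefree n) (P : ℕ → Prop)
    (h : ∀ p : ℕ, p.Prime → p ∣ n → jacobiSym a p = if P p then 1 else -1) :
    jacobiSym a n = (-1) ^ (n.primeFactors.filter fun p => ¬ P p).card := by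
  have key : ∀ S : Finset ℕ, S ⊆ n.primeFactors →
      jacobiSym a (∏ p ∈ S, p) = (-1) ^ (S.filter fun p => ¬ P p).card := by
    intro S
    induction S using Finset.induction_on with
    | empty => simp
    | insert p S hpS ih =>
      intro hS
      have hp := Nat.mem_primeFactors.mp (hS (Finset.mem_insert_self p S))
      have hS' := (Finset.subset_insert p S).trans hS
      have hprod : ∏ r ∈ S, r ≠ 0 :=
        Finset.prod_ne_zero_iff.mpr fun r hr => (Nat.prime_of_mem_primeFactors (hS' hr)).ne_zero
      rw [Finset.prod_insert hpS, jacobiSym.mul_right' _ hp.1.ne_zero hprod, ih hS',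
        h p hp.1 hp.2.1, Finset.filter_insert]
      by_cases hP : P p
      · simp [hP]
      · simp [hP, hpS, pow_succ]
  have := key n.primeFactors subset_rfl
  rwa [Nat.prod_primeFactors_of_squarefree hn] at this

theorem jacobiSym_mul_sq_left {a c : ℤ} {b : ℕ} (h : IsCoprime (b : ℤ) c) :
    jacobiSym (a * c ^ 2) b = jacobiSym a b := by
  rw [jacobiSym.mul_left, jacobiSym.sq_one' (Int.isCoprime_iff_gcd_eq_one.mp h.symm), mul_one]

theorem jacobiSym_eq_of_dvd_sub {a c : ℤ} {b : ℕ} (h : (b : ℤ) ∣ a - c) :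
    jacobiSym a b = jacobiSym c b :=
  jacobiSym.mod_left' (Int.ModEq.symm ((Int.modEq_iff_dvd).mpr h))

/-- If `x² + q y² = n z²` and `x² - q y² = w²`, then `x` and `n` have Jacobi symbol `(-1/x)`. -/
theorem jacobiSym_left_of_eqs {X n : ℕ} {q y z w : ℤ} (hn : n % 4 = 1) (hX : Odd X)
    (hxy : IsCoprime (X : ℤ) y) (hxz : IsCoprime (X : ℤ) z) (hxw : IsCoprime (X : ℤ) w)
    (e1 : (X : ℤ) ^ 2 + q * y ^ 2 = n * z ^ 2) (e2 : (X : ℤ) ^ 2 - q * y ^ 2 = w ^ 2) :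
    jacobiSym X n = ZMod.χ₄ X := by
  have h1 : jacobiSym n X = jacobiSym q X := by
    rw [← jacobiSym_mul_sq_left (a := (n : ℤ)) hxz, ← jacobiSym_mul_sq_left (a := q) hxy]
    exact jacobiSym_eq_of_dvd_sub ⟨X, by linear_combination -e1⟩
  have h2 : jacobiSym (-q) X = 1 := by
    rw [← jacobiSym_mul_sq_left (a := -q) hxy, ← jacobiSym.one_left X,
      ← jacobiSym_mul_sq_left (a := 1) hxw]
    exact jacobiSym_eq_of_dvd_sub ⟨-X, by linear_combination e2⟩
  have h3 : jacobiSym q X = ZMod.χ₄ X := by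
    rw [← neg_neg q, neg_eq_neg_one_mul (-q), jacobiSym.mul_left, h2, mul_one,
      jacobiSym.at_neg_one hX]
  rw [← h3, ← h1, jacobiSym.quadratic_reciprocity_one_mod_four hn hX]

/-- If `n ≡ 1 (mod 8)` and `n z²` is congruent to `x²` modulo `y`, with `y` coprime to `x z`, then
`y` has Jacobi symbol `1` modulo `n`. -/
theorem jacobiSym_right_of_dvd {Y n : ℕ} {x z : ℤ} (hn : n % 8 = 1) (hY : Y ≠ 0)
    (hxy : IsCoprime (Y : ℤ) x) (hyz : IsCoprime (Y : ℤ) z)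
    (h : (Y : ℤ) ∣ n * z ^ 2 - x ^ 2) : jacobiSym Y n = 1 := by
  obtain ⟨k, m, hm, rfl⟩ := Nat.exists_eq_two_pow_mul_odd hY
  have hdvd : (m : ℤ) ∣ ((2 ^ k * m : ℕ) : ℤ) := Int.natCast_dvd_natCast.mpr (dvd_mul_left _ _)
  have hnodd : Odd n := by rw [Nat.odd_iff]; omega
  have h2 : jacobiSym 2 n = 1 := by
    rw [jacobiSym.at_two hnodd, ZMod.χ₈_nat_eq_if_mod_eight]
    simp [hn, show n % 2 ≠ 0 by omega]
  have hmn : jacobiSym m n = 1 := by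
    rw [← jacobiSym.quadratic_reciprocity_one_mod_four (by omega) hm,
      ← jacobiSym_mul_sq_left (a := (n : ℤ)) (hyz.of_isCoprime_of_dvd_left hdvd),
      ← jacobiSym.one_left m,
      ← jacobiSym_mul_sq_left (a := 1) (hxy.of_isCoprime_of_dvd_left hdvd)]
    exact jacobiSym_eq_of_dvd_sub (by simpa using hdvd.trans h)
  push_cast
  rw [jacobiSym.mul_left, jacobiSym.pow_left, h2, hmn]
  simp

theorem Nat.mod_eight_eq_one_of_primeFactors {n : ℕ} (hn : n ≠ 0)
    (h : ∀ p : ℕ, p.Prime → p ∣ n → p % 8 = 1) : n % 8 = 1 := by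
  induction n using Nat.recOnMul with
  | zero => exact absurd rfl hn
  | one => rfl
  | prime p hp => exact h p hp dvd_rfl
  | mul a b iha ihb =>
    have ha := iha (by rintro rfl; simp at hn) fun p hp hd => h p hp (hd.mul_right b)
    have hb := ihb (by rintro rfl; simp at hn) fun p hp hd => h p hp (hd.mul_left a)
    rw [Nat.mul_mod, ha, hb]

open scoped Classical in
theorem stmt10 (q : ℕ) (hq : q.Prime) (hqmod : q % 8 = 3)
    (nq : ℕ) (hnq0 : 0 < nq) (hsf : Squarefree nq)
    (hfac : ∀ r : ℕ, r.Prime → r ∣ nq → r % 8 = 1)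
    (hQR : ∀ r : ℕ, r.Prime → r ∣ nq → IsSquare ((q : ZMod r)))
    (x y z w : ℤ)
    (hxy : IsCoprime x y) (hxz : IsCoprime x z) (hxw : IsCoprime x w)
    (hyz : IsCoprime y z) (hyw : IsCoprime y w) (hzw : IsCoprime z w)
    (hx : Odd x) (hx0 : 0 < x) (hz : Odd z) (hz0 : 0 < z) (hw : Odd w) (hw0 : 0 < w)
    (hy : Even y) (hy0 : y ≠ 0)
    (e1 : x ^ 2 + (q : ℤ) * y ^ 2 = (nq : ℤ) * z ^ 2)
    (e2 : x ^ 2 - (q : ℤ) * y ^ 2 = w ^ 2) :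
    x % 4 = 1 ↔
      Even ((nq.primeFactors.filter fun r => ¬ ∃ s : ZMod r, s ^ 4 = (q : ZMod r)).card) := by
  have hn8 := Nat.mod_eight_eq_one_of_primeFactors hnq0.ne' hfac
  obtain ⟨X, rfl⟩ := Int.eq_ofNat_of_zero_le hx0.le
  have hX : Odd X := by exact_mod_cast hx
  have hsq : (y.natAbs : ℤ) ^ 2 = y ^ 2 := Int.natAbs_sq y
  have hxY : IsCoprime (X : ℤ) y.natAbs := by
    rw [Int.natCast_natAbs]; exact hxy.abs_right
  have hYz : IsCoprime (y.natAbs : ℤ) z := by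
    rw [Int.natCast_natAbs]; exact hyz.abs_left
  have hY0 : y.natAbs ≠ 0 := Int.natAbs_ne_zero.mpr hy0
  rw [← hsq] at e1 e2
  generalize y.natAbs = Y at *
  have hJ : jacobiSym (X * Y) nq = ZMod.χ₄ X := by
    rw [jacobiSym.mul_left, jacobiSym_left_of_eqs (by omega) hX hxY hxz hxw e1 e2,
      jacobiSym_right_of_dvd hn8 hY0 hxY.symm hYz ⟨q * Y, by linear_combination -e1⟩, mul_one]
  have hlocal : ∀ p : ℕ, p.Prime → p ∣ nq → jacobiSym (X * Y) p =
      if ∃ s : ZMod p, s ^ 4 = (q : ZMod p) then 1 else -1 := by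
    intro p hp hpn
    have : Fact p.Prime := ⟨hp⟩
    obtain ⟨ζ, hζ⟩ := ZMod.exists_pow_four_eq_neg_one (hfac p hp hpn)
    have hn0 : (nq : ZMod p) = 0 := (ZMod.natCast_eq_zero_iff nq p).mpr hpn
    have heq : (X : ZMod p) ^ 2 + q * (Y : ZMod p) ^ 2 = 0 := by
      have := congrArg (Int.cast : ℤ → ZMod p) e1
      push_cast at this
      rw [this, hn0, zero_mul]
    have hcop : IsCoprime (X : ZMod p) (Y : ZMod p) := by
      simpa using hxY.map (Int.castRingHom (ZMod p))
    have hq0 : (q : ZMod p) ≠ 0 := by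
      rw [Ne, ZMod.natCast_eq_zero_iff, Nat.prime_dvd_prime_iff_eq hp hq]
      rintro rfl
      have := hfac p hp hpn
      omega
    have hYp : (Y : ZMod p) ≠ 0 := by
      intro h
      have hX0 : (X : ZMod p) = 0 := by simpa [h] using heq
      rw [h, hX0] at hcop
      exact not_isCoprime_zero_zero hcop
    have hXp : (X : ZMod p) ≠ 0 := by
      intro h
      rw [h] at heq
      simp [hq0, hYp] at heq
    have hne : (((X * Y : ℤ)) : ZMod p) ≠ 0 := by
      push_cast
      exact mul_ne_zero hXp hYp
    have hiff := exists_pow_four_eq_iff_isSquare_mul hζ hYp heq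
    rw [← jacobiSym.legendreSym.to_jacobiSym]
    split_ifs with hs
    · rw [legendreSym.eq_one_iff p hne]
      simpa using hiff.mp hs
    · rw [legendreSym.eq_neg_one_iff]
      simpa using fun h => hs (hiff.mpr h)
  rw [jacobiSym_eq_neg_one_pow_card hsf _ hlocal] at hJ
  have hX4 : X % 4 = 1 ∨ X % 4 = 3 := by
    have := Nat.odd_iff.mp hX
    omega
  rw [← neg_one_pow_eq_one_iff_even (R := ℤ) (by decide), hJ]
  rcases hX4 with h | h
  · simp [ZMod.χ₄_nat_one_mod_four h]
    omega
  · simp [ZMod.χ₄_nat_three_mod_four h]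
    omega
end

section
/- Let n_q be a squarefree positive integer all of whose prime factors are congruent to 1 modulo 8, and write n_q = u² + 2v² with u an odd positive integer and v an even positive integer. Suppose x, z, w are pairwise coprime odd positive integers satisfying 2x² = n_q·z² + w². Then x ≡ 1 (mod 4) if and only if v ≡ 0 (mod 4). -/
/-- If `a * b` is a sum of two squares `s ^ 2 + w ^ 2` and no prime `q ≡ 3 mod 4` divides `a`, `b`
and `w` simultaneously, then an odd `a` is congruent to `1` modulo `4`. -/
theorem mod_four_eq_one_of_mul_eq_sq_add_sq {a b s w : ℕ} (ha : Odd a) (hb : b ≠ 0)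
    (h : a * b = s ^ 2 + w ^ 2)
    (hab : ∀ q : ℕ, q.Prime → q % 4 = 3 → q ∣ a → q ∣ b → ¬ q ∣ w) : a % 4 = 1 := by
  have ha0 : a ≠ 0 := ha.pos.ne'
  obtain ⟨c, d, hcd⟩ : ∃ c d : ℕ, a = c ^ 2 + d ^ 2 := by
    refine Nat.eq_sq_add_sq_iff.mpr fun {q} hq hq3 ↦ ?_
    obtain ⟨hqp, hqa, -⟩ := Nat.mem_primeFactors.mp hq
    have : Fact q.Prime := ⟨hqp⟩
    have hqw : q ∣ w := by
      by_contra hqw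
      have hz : ((s ^ 2 + w ^ 2 : ℕ) : ZMod q) = 0 :=
        (ZMod.natCast_eq_zero_iff _ _).mpr (h ▸ hqa.mul_right b)
      push_cast at hz
      exact ZMod.mod_four_ne_three_of_sq_eq_neg_sq'
        (fun h0 ↦ hqw ((ZMod.natCast_eq_zero_iff _ _).mp h0)) (eq_neg_of_add_eq_zero_left hz) hq3
    have hqb : ¬ q ∣ b := fun hqb ↦ hab q hqp hq3 hqa hqb hqw
    have heven := Nat.eq_sq_add_sq_iff.mp ⟨s, w, h⟩ q
      (Nat.mem_primeFactors.mpr ⟨hqp, hqa.mul_right b, mul_ne_zero ha0 hb⟩) hq3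
    rwa [padicValNat.mul ha0 hb, padicValNat.eq_zero_of_not_dvd hqb, add_zero] at heven
  have h2 := Nat.odd_iff.mp ha
  have hc : c ^ 2 % 4 = 0 ∨ c ^ 2 % 4 = 1 := by
    have := Nat.mod_lt c (show 4 > 0 by norm_num)
    rw [Nat.pow_mod]; interval_cases c % 4 <;> simp
  have hd : d ^ 2 % 4 = 0 ∨ d ^ 2 % 4 = 1 := by
    have := Nat.mod_lt d (show 4 > 0 by norm_num)
    rw [Nat.pow_mod]; interval_cases d % 4 <;> simp
  omega

theorem stmt11 (nq : ℕ) (hnq0 : 0 < nq) (hsf : Squarefree nq)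
    (hfac : ∀ r : ℕ, r.Prime → r ∣ nq → r % 8 = 1)
    (u v : ℕ) (hu : Odd u) (hu0 : 0 < u) (hv : Even v) (hv0 : 0 < v)
    (hrep : (nq : ℤ) = u ^ 2 + 2 * v ^ 2)
    (x z w : ℤ)
    (hxz : IsCoprime x z) (hxw : IsCoprime x w) (hzw : IsCoprime z w)
    (hx : Odd x) (hx0 : 0 < x) (hz : Odd z) (hz0 : 0 < z) (hw : Odd w) (hw0 : 0 < w)
    (heq : 2 * x ^ 2 = (nq : ℤ) * z ^ 2 + w ^ 2) :
    x % 4 = 1 ↔ v % 4 = 0 := by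
  have hprod : (x + v * z) * (2 * (x - v * z)) = (u * z) ^ 2 + w ^ 2 := by
    rw [hrep] at heq
    linear_combination heq
  have hA : 0 < x + v * z := by positivity
  have hB : 0 < 2 * (x - v * z) := by
    refine pos_of_mul_pos_right (a := x + v * z) ?_ hA.le
    rw [hprod]
    positivity
  obtain ⟨a, ha⟩ := Int.eq_ofNat_of_zero_le hA.le
  obtain ⟨b, hb⟩ := Int.eq_ofNat_of_zero_le hB.le
  obtain ⟨k, hk⟩ := hv
  obtain ⟨m, hm⟩ := hz
  have hvz : (v : ℤ) * z = v + 4 * (k * m) := by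
    rw [hm, hk]; push_cast; ring
  have hodd := Int.odd_iff.mp hx
  have key : a % 4 = 1 := by
    refine mod_four_eq_one_of_mul_eq_sq_add_sq (b := b) (s := u * z.natAbs) (w := w.natAbs)
      (Nat.odd_iff.mpr (by omega)) (by omega) ?_ fun q hq hq3 hqa hqb hqw ↦ ?_
    · zify
      rw [abs_of_pos hz0, abs_of_pos hw0, ← ha, ← hb, hprod]
    · have hqp : Prime (q : ℤ) := Nat.prime_iff_prime_int.mp hq
      have h4x : (q : ℤ) ∣ 2 ^ 2 * x := by
        have hsum : 2 ^ 2 * x = 2 * (a : ℤ) + b := by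
          linear_combination 2 * ha + hb
        rw [hsum]
        exact ((Int.natCast_dvd_natCast.mpr hqa).mul_left 2).add (Int.natCast_dvd_natCast.mpr hqb)
      have hqx : (q : ℤ) ∣ x := by
        refine (hqp.dvd_or_dvd h4x).resolve_left fun h2 ↦ ?_
        have := Nat.le_of_dvd two_pos (Int.natCast_dvd_natCast.mp (hqp.dvd_of_dvd_pow h2))
        omega
      exact hqp.not_isUnit (hxw.isUnit_of_dvd' hqx (Int.natCast_dvd.mpr hqw))
  omega
end

section
/- Let q be a prime with q ≡ 3 (mod 8), and let n_q be a squarefree positive integer all of whose prime factors are congruent to 1 modulo 8, such that q is a quadratic residue modulo every prime factor of n_q. Suppose x, y, z, w are pairwise coprime integers with x, z, w odd and positive and y even and nonzero, satisfying x² + q·y² = z² and x² − q·y² = n_q·w². Then x ≡ 1 (mod 4) if and only if the number of primes p dividing n_q for which q is not a quartic residue modulo p is even. -/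
/-- If `x² = q y²` modulo a prime `p ≡ 1 [MOD 4]` not dividing `x` or `y`, then `q` is a quartic
residue modulo `p` exactly when `x y` is a quadratic residue modulo `p`. -/
theorem exists_pow_four_eq_iff_legendreSym_mul {p : ℕ} [Fact p.Prime] (hp : p % 4 = 1)
    {q : ZMod p} {x y : ℤ} (hx0 : (x : ZMod p) ≠ 0) (hy0 : (y : ZMod p) ≠ 0)
    (h : (x : ZMod p) ^ 2 = q * (y : ZMod p) ^ 2) :
    (∃ s : ZMod p, s ^ 4 = q) ↔ legendreSym p (x * y) = 1 := by
  have hxy0 : ((x * y : ℤ) : ZMod p) ≠ 0 := by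
    push_cast
    exact mul_ne_zero hx0 hy0
  rw [legendreSym.eq_one_iff p hxy0]
  push_cast
  constructor
  · rintro ⟨s, rfl⟩
    obtain ⟨i, hi⟩ : IsSquare (-1 : ZMod p) := ZMod.exists_sq_eq_neg_one_iff.mpr (by omega)
    have hfactor : ((x : ZMod p) - s ^ 2 * y) * (x + s ^ 2 * y) = 0 := by
      linear_combination h
    rcases mul_eq_zero.mp hfactor with h1 | h1
    · exact ⟨s * y, by linear_combination (y : ZMod p) * h1⟩
    · exact ⟨i * s * y, by
        linear_combination (y : ZMod p) * h1 + s ^ 2 * (y : ZMod p) ^ 2 * hi⟩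
  · rintro ⟨t, ht⟩
    refine ⟨t / y, ?_⟩
    rw [div_pow, div_eq_iff (pow_ne_zero 4 hy0)]
    linear_combination (y : ZMod p) ^ 2 * h - (t * t + (x : ZMod p) * y) * ht

theorem jacobiSym_finset_prod_right (a : ℤ) (s : Finset ℕ) (hs : ∀ p ∈ s, p ≠ 0) :
    jacobiSym a (∏ p ∈ s, p) = ∏ p ∈ s, jacobiSym a p := by
  induction s using Finset.induction_on with
  | empty => simp
  | insert p s hp ih =>
    have hs' : ∀ r ∈ s, r ≠ 0 := fun r hr => hs r (Finset.mem_insert_of_mem hr)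
    rw [Finset.prod_insert hp, Finset.prod_insert hp,
      jacobiSym.mul_right' a (hs p (Finset.mem_insert_self p s)) (Finset.prod_ne_zero_iff.mpr hs'),
      ih hs']

theorem mod_eight_eq_one_of_forall_prime_dvd {n : ℕ} (hn : n ≠ 0)
    (h : ∀ r : ℕ, r.Prime → r ∣ n → r % 8 = 1) : n % 8 = 1 := by
  induction n using induction_on_primes with
  | zero => exact absurd rfl hn
  | one => rfl
  | prime_mul p a hp ih =>
    rw [Nat.mul_mod, h p hp (dvd_mul_right p a),
      ih (right_ne_zero_of_mul hn) fun r hr hra => h r hr (hra.mul_left p)]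

theorem jacobiSym_sq_left_eq_one {a : ℤ} {b : ℕ} (h : IsCoprime a b) :
    jacobiSym (a ^ 2) b = 1 :=
  jacobiSym.sq_one' (Int.isCoprime_iff_gcd_eq_one.mp h)

/-- If `n w² ≡ a² [ZMOD b]`, with `a` and `w` coprime to `b` and `n ≡ 1 [MOD 8]`,
then the Jacobi symbol of `b` modulo `n` is `1`. -/
theorem jacobiSym_eq_one_of_mul_sq_modEq_sq {n : ℕ} (hn : n % 8 = 1) {b a w : ℤ} (hb : b ≠ 0)
    (ha : IsCoprime a b) (hw : IsCoprime w b) (h : b ∣ n * w ^ 2 - a ^ 2) :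
    jacobiSym b n = 1 := by
  have hodd : Odd n := Nat.odd_iff.mpr (by omega)
  have htwo : jacobiSym 2 n = 1 := by
    rw [jacobiSym.at_two hodd, ZMod.χ₈_nat_mod_eight, hn]
    rfl
  obtain ⟨k, m, hm, hbm⟩ := Nat.exists_eq_two_pow_mul_odd (Int.natAbs_ne_zero.mpr hb)
  have hmb : (m : ℤ) ∣ b := Int.natCast_dvd.mpr ⟨2 ^ k, by rw [hbm, mul_comm]⟩
  have hm1 : jacobiSym m n = 1 := by
    have hnw : jacobiSym (n * w ^ 2) m = jacobiSym (a ^ 2) m :=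
      jacobiSym.mod_left' (Int.modEq_iff_dvd.mpr (hmb.trans h)).symm
    rw [jacobiSym.mul_left, jacobiSym_sq_left_eq_one (hw.of_isCoprime_of_dvd_right hmb),
      jacobiSym_sq_left_eq_one (ha.of_isCoprime_of_dvd_right hmb), mul_one] at hnw
    rw [jacobiSym.quadratic_reciprocity_one_mod_four' hm (by omega), hnw]
  have habs : jacobiSym (b.natAbs : ℤ) n = 1 := by
    rw [hbm]
    push_cast
    rw [jacobiSym.mul_left, jacobiSym.pow_left, htwo, hm1, one_pow, one_mul]
  rcases Int.natAbs_eq b with hb' | hb' <;> rw [hb']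
  · exact habs
  · rw [jacobiSym.neg _ hodd, habs, ZMod.χ₄_nat_one_mod_four (by omega), one_mul]

open scoped Classical in
theorem stmt12 (q : ℕ) (hq : q.Prime) (hqmod : q % 8 = 3)
    (nq : ℕ) (hnq0 : 0 < nq) (hsf : Squarefree nq)
    (hfac : ∀ r : ℕ, r.Prime → r ∣ nq → r % 8 = 1)
    (hQR : ∀ r : ℕ, r.Prime → r ∣ nq → IsSquare ((q : ZMod r)))
    (x y z w : ℤ)
    (hxy : IsCoprime x y) (hxz : IsCoprime x z) (hxw : IsCoprime x w)
    (hyz : IsCoprime y z) (hyw : IsCoprime y w) (hzw : IsCoprime z w)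
    (hx : Odd x) (hx0 : 0 < x) (hz : Odd z) (hz0 : 0 < z) (hw : Odd w) (hw0 : 0 < w)
    (hy : Even y) (hy0 : y ≠ 0)
    (e1 : x ^ 2 + (q : ℤ) * y ^ 2 = z ^ 2)
    (e2 : x ^ 2 - (q : ℤ) * y ^ 2 = (nq : ℤ) * w ^ 2) :
    x % 4 = 1 ↔
      Even ((nq.primeFactors.filter fun r => ¬ ∃ s : ZMod r, s ^ 4 = (q : ZMod r)).card) := by
  have hn8 : nq % 8 = 1 := mod_eight_eq_one_of_forall_prime_dvd hnq0.ne' hfac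
  have hy1 : jacobiSym y nq = 1 :=
    jacobiSym_eq_one_of_mul_sq_modEq_sq hn8 hy0 hxy hyw.symm
      ⟨-(q * y), by linear_combination -e2⟩
  have hlocal : ∀ p ∈ nq.primeFactors,
      jacobiSym (x * y) p = if ¬ ∃ s : ZMod p, s ^ 4 = (q : ZMod p) then -1 else 1 := by
    intro p hp
    obtain ⟨hpp, hpn, -⟩ := Nat.mem_primeFactors.mp hp
    have : Fact p.Prime := ⟨hpp⟩
    have hp8 := hfac p hpp hpn
    have hsq : (x : ZMod p) ^ 2 = q * (y : ZMod p) ^ 2 := by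
      have h := congrArg (Int.cast : ℤ → ZMod p) e2
      push_cast at h
      rw [(ZMod.natCast_eq_zero_iff nq p).mpr hpn] at h
      linear_combination h
    obtain ⟨u, v, huv⟩ := hxy
    have hcop : (u : ZMod p) * x + v * y = 1 := by
      exact_mod_cast congrArg (Int.cast : ℤ → ZMod p) huv
    have hyp : (y : ZMod p) ≠ 0 := by
      intro h0
      have : (x : ZMod p) = 0 := by simpa [h0] using hsq
      simp [h0, this] at hcop
    have hqp : (q : ZMod p) ≠ 0 := by
      rw [Ne, ZMod.natCast_eq_zero_iff, Nat.prime_dvd_prime_iff_eq hpp hq]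
      omega
    have hxp : (x : ZMod p) ≠ 0 := by
      intro h0
      rw [h0, zero_pow two_ne_zero] at hsq
      exact mul_ne_zero hqp (pow_ne_zero 2 hyp) hsq.symm
    have key := exists_pow_four_eq_iff_legendreSym_mul (by omega) hxp hyp hsq
    rw [← jacobiSym.legendreSym.to_jacobiSym]
    have hxy0 : ((x * y : ℤ) : ZMod p) ≠ 0 := by
      push_cast
      exact mul_ne_zero hxp hyp
    split_ifs with hs
    · exact key.mp hs
    · exact (legendreSym.eq_one_or_neg_one p hxy0).resolve_left (mt key.mpr hs)
  have hprod : jacobiSym (x * y) nq =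
      (-1) ^ (nq.primeFactors.filter fun r => ¬ ∃ s : ZMod r, s ^ 4 = (q : ZMod r)).card := by
    conv_lhs => rw [← Nat.prod_primeFactors_of_squarefree hsf]
    rw [jacobiSym_finset_prod_right _ _ fun p hp => (Nat.prime_of_mem_primeFactors hp).ne_zero,
      Finset.prod_congr rfl hlocal, Finset.prod_ite, Finset.prod_const, Finset.prod_const_one,
      mul_one]
  lift x to ℕ using hx0.le
  have hxodd : Odd x := by exact_mod_cast hx
  have hqx : jacobiSym q x = 1 := by
    have h : jacobiSym (q * y ^ 2) x = jacobiSym (z ^ 2) x :=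
      jacobiSym.mod_left' (Int.modEq_iff_dvd.mpr ⟨x, by linear_combination -e1⟩)
    rwa [jacobiSym.mul_left, jacobiSym_sq_left_eq_one hxy.symm, jacobiSym_sq_left_eq_one hxz.symm,
      mul_one] at h
  have hx1 : jacobiSym x nq = jacobiSym (-1) x := by
    have h : jacobiSym (nq * w ^ 2) x = jacobiSym (-1 * (q * y ^ 2)) x :=
      jacobiSym.mod_left' (Int.modEq_iff_dvd.mpr ⟨-x, by linear_combination e2⟩)
    rwa [jacobiSym.mul_left, jacobiSym.mul_left, jacobiSym.mul_left,
      jacobiSym_sq_left_eq_one hxy.symm, jacobiSym_sq_left_eq_one hxw.symm, hqx,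
      mul_one, mul_one, mul_one,
      ← jacobiSym.quadratic_reciprocity_one_mod_four' hxodd (by omega)] at h
  rw [jacobiSym.mul_left, hy1, mul_one, hx1, jacobiSym.at_neg_one hxodd] at hprod
  rw [← neg_one_pow_eq_one_iff_even (R := ℤ) (by norm_num), ← hprod]
  have hx2 := Nat.odd_iff.mp hxodd
  rcases (by omega : x % 4 = 1 ∨ x % 4 = 3) with h | h
  · simp [ZMod.χ₄_nat_one_mod_four h]; omega
  · simp [ZMod.χ₄_nat_three_mod_four h]; omega
end

section
/- Let n_q be a squarefree positive integer all of whose prime factors are congruent to 1 modulo 8, and write n_q = 2e² − f² with e and f odd positive integers. Suppose x, z, w are pairwise coprime odd positive integers satisfying 2·n_q·x² = z² + w². Then x ≡ 1 (mod 4), and moreover z ≡ ±1 (mod 8) (i.e., the Jacobi symbol (2/z) equals 1) if and only if e ≡ 1 (mod 4). -/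
theorem Int.emod_four_eq_one_of_dvd_sq_add_sq {x s t : ℤ} (hx : Odd x) (hx0 : 0 < x)
    (hst : IsCoprime s t) (hdvd : x ∣ s ^ 2 + t ^ 2) : x % 4 = 1 := by
  lift x to ℕ using hx0.le
  obtain ⟨N, hN⟩ := Int.eq_ofNat_of_zero_le (by positivity : 0 ≤ s ^ 2 + t ^ 2)
  have hsq : IsSquare (-1 : ZMod N) :=
    ZMod.isSquare_neg_one_of_eq_sq_add_sq_of_isCoprime hN.symm hst
  have hxN : x ∣ N := by
    rw [hN] at hdvd
    exact_mod_cast hdvd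
  obtain ⟨a, b, hab⟩ :=
    Nat.eq_sq_add_sq_of_isSquare_mod_neg_one (ZMod.isSquare_neg_one_of_dvd hxN hsq)
  have hodd : x % 2 = 1 := Nat.odd_iff.mp (by exact_mod_cast hx)
  have ha : a ^ 2 % 4 = 0 ∨ a ^ 2 % 4 = 1 := by
    rcases Nat.even_or_odd' a with ⟨k, rfl | rfl⟩ <;> ring_nf <;> omega
  have hb : b ^ 2 % 4 = 0 ∨ b ^ 2 % 4 = 1 := by
    rcases Nat.even_or_odd' b with ⟨k, rfl | rfl⟩ <;> ring_nf <;> omega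
  omega

theorem Nat.Prime.mod_eight_of_dvd_sq_add_two_mul_sq {p : ℕ} (hp : p.Prime) (hp2 : p ≠ 2)
    {u v : ℤ} (hdvd : (p : ℤ) ∣ u ^ 2 + 2 * v ^ 2) (huv : ¬((p : ℤ) ∣ u ∧ (p : ℤ) ∣ v)) :
    p % 8 = 1 ∨ p % 8 = 3 := by
  have : Fact p.Prime := ⟨hp⟩
  rw [← ZMod.exists_sq_eq_neg_two_iff hp2]
  have h : (u : ZMod p) ^ 2 + 2 * (v : ZMod p) ^ 2 = 0 := by
    exact_mod_cast (ZMod.intCast_zmod_eq_zero_iff_dvd _ p).mpr hdvd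
  have hv : (v : ZMod p) ≠ 0 := by
    intro hv
    have hu : (u : ZMod p) = 0 := by simpa [hv] using h
    exact huv ⟨(ZMod.intCast_zmod_eq_zero_iff_dvd _ p).mp hu,
      (ZMod.intCast_zmod_eq_zero_iff_dvd _ p).mp hv⟩
  refine ⟨(u : ZMod p) / v, ?_⟩
  field_simp
  linear_combination -h

/-- An odd divisor `A` of `u ^ 2 + 2 * v ^ 2` whose cofactor is prime to `gcd A u v` is congruent
to `1` or `3` modulo `8`. -/
theorem Nat.mod_eight_of_mul_eq_sq_add_two_mul_sq (A : ℕ) (hA : Odd A) (B u v : ℤ)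
    (h : A * B = u ^ 2 + 2 * v ^ 2)
    (hB : ∀ q : ℕ, q.Prime → q ∣ A → (q : ℤ) ∣ u → (q : ℤ) ∣ v → ¬(q : ℤ) ∣ B) :
    A % 8 = 1 ∨ A % 8 = 3 := by
  induction A using Nat.strong_induction_on generalizing B u v with
  | _ A ih =>
  rcases eq_or_ne A 1 with rfl | hA1
  · simp
  obtain ⟨p, hp, hpA⟩ := Nat.exists_prime_and_dvd hA1
  have hpodd : Odd p := hA.of_dvd_nat hpA
  have hp2 : p ≠ 2 := by rintro rfl; revert hpodd; decide
  have hp0 : (p : ℤ) ≠ 0 := by exact_mod_cast hp.ne_zero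
  by_cases huv : (p : ℤ) ∣ u ∧ (p : ℤ) ∣ v
  · have hpB := hB p hp hpA huv.1 huv.2
    obtain ⟨⟨u, rfl⟩, ⟨v, rfl⟩⟩ := huv
    have hcop : IsCoprime ((p : ℤ) ^ 2) B :=
      IsCoprime.pow_left (((Nat.prime_iff_prime_int.mp hp).coprime_iff_not_dvd).mpr hpB)
    have hdvd : (p : ℤ) ^ 2 ∣ A :=
      hcop.dvd_of_dvd_mul_right ⟨u ^ 2 + 2 * v ^ 2, by rw [h]; ring⟩
    obtain ⟨A', rfl⟩ : p ^ 2 ∣ A := by exact_mod_cast hdvd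
    have hA' : Odd A' := (Nat.odd_mul.mp hA).2
    have hlt : A' < p ^ 2 * A' :=
      lt_mul_of_one_lt_left hA'.pos (Nat.one_lt_pow two_ne_zero hp.one_lt)
    have key := ih A' hlt hA' B u v
      (mul_left_cancel₀ (pow_ne_zero 2 hp0) (by push_cast at h; linear_combination h))
      fun q hq hqA hqu hqv =>
        hB q hq (hqA.mul_left _) (hqu.mul_left _) (hqv.mul_left _)
    have hsq : p ^ 2 % 8 = 1 := by
      have : p % 8 = 1 ∨ p % 8 = 3 ∨ p % 8 = 5 ∨ p % 8 = 7 := by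
        have := Nat.odd_iff.mp hpodd
        omega
      rcases this with h | h | h | h <;> simp [Nat.pow_mod, h]
    rwa [Nat.mul_mod, hsq, one_mul, Nat.mod_mod]
  · obtain ⟨A', rfl⟩ := hpA
    have hA' : Odd A' := (Nat.odd_mul.mp hA).2
    have hlt : A' < p * A' := lt_mul_of_one_lt_left hA'.pos hp.one_lt
    have key := ih A' hlt hA' (p * B) u v (by push_cast at h; linear_combination h)
      fun q hq hqA hqu hqv hqpB => by
        rcases (Nat.prime_iff_prime_int.mp hq).dvd_or_dvd hqpB with hqp | hqB
        · obtain rfl := (Nat.prime_dvd_prime_iff_eq hq hp).mp (by exact_mod_cast hqp)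
          exact huv ⟨hqu, hqv⟩
        · exact hB q hq (hqA.mul_left _) hqu hqv hqB
    have hp8 := hp.mod_eight_of_dvd_sq_add_two_mul_sq hp2
      (u := u) (v := v) ⟨A' * B, by push_cast at h; linear_combination -h⟩ huv
    rcases hp8 with h1 | h1 <;> rcases key with h2 | h2 <;> simp [Nat.mul_mod, h1, h2]

theorem stmt14 (nq : ℕ) (hnq0 : 0 < nq) (hsf : Squarefree nq)
    (hfac : ∀ r : ℕ, r.Prime → r ∣ nq → r % 8 = 1)
    (e f : ℕ) (he : Odd e) (he0 : 0 < e) (hf : Odd f) (hf0 : 0 < f)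
    (hrep : (nq : ℤ) = 2 * e ^ 2 - f ^ 2)
    (x z w : ℤ)
    (hxz : IsCoprime x z) (hxw : IsCoprime x w) (hzw : IsCoprime z w)
    (hx : Odd x) (hx0 : 0 < x) (hz : Odd z) (hz0 : 0 < z) (hw : Odd w) (hw0 : 0 < w)
    (heq : 2 * (nq : ℤ) * x ^ 2 = z ^ 2 + w ^ 2) :
    x % 4 = 1 ∧ ((z % 8 = 1 ∨ z % 8 = 7) ↔ e % 4 = 1) := by
  have hx4 : x % 4 = 1 :=
    Int.emod_four_eq_one_of_dvd_sq_add_sq hx hx0 hzw ⟨2 * nq * x, by rw [← heq]; ring⟩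
  refine ⟨hx4, ?_⟩
  obtain ⟨A, hA⟩ := Int.eq_ofNat_of_zero_le (by positivity : 0 ≤ 2 * (e : ℤ) * x + z)
  have hAodd : Odd A := by
    have : Odd (A : ℤ) := by
      rw [← hA, mul_assoc]
      exact (even_two_mul _).add_odd hz
    exact_mod_cast this
  have key := Nat.mod_eight_of_mul_eq_sq_add_two_mul_sq A hAodd (2 * e * x - z) w (f * x)
    (by rw [← hA]; rw [hrep] at heq; linear_combination heq)
    fun q hq hqA hqw _ hqB => by
      have hqA' : (q : ℤ) ∣ 2 * e * x + z := by rw [hA]; exact_mod_cast hqA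
      have hq2z : (q : ℤ) ∣ 2 * z := by
        have := dvd_sub hqA' hqB
        ring_nf at this ⊢
        exact this
      have hqodd : Odd q := hAodd.of_dvd_nat hqA
      have hqprime := Nat.prime_iff_prime_int.mp hq
      rcases hqprime.dvd_or_dvd hq2z with h2 | hqz
      · obtain rfl := (Nat.prime_dvd_prime_iff_eq hq Nat.prime_two).mp (by exact_mod_cast h2)
        revert hqodd
        decide
      · exact hqprime.not_isUnit (hzw.isUnit_of_dvd' hqz hqw)
  obtain ⟨k, hk⟩ : ∃ k, x = 4 * k + 1 := ⟨x / 4, by omega⟩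
  have hA' : (A : ℤ) = 8 * (e * k) + 2 * e + z := by rw [← hA, hk]; ring
  have := Nat.odd_iff.mp he
  have := Int.odd_iff.mp hz
  generalize (e : ℤ) * k = m at hA'
  omega
end

section
/- Let n be a squarefree positive integer. Then n is a congruent number if and only if the elliptic curve E_n : y² = x³ − n²x over ℚ has a rational point of infinite order (i.e., there exists a point P in the group E_n(ℚ) that is not of finite order). -/
/-- A positive integer `n` is a congruent number if it is the area of a right
triangle with rational side lengths. -/
def IsCongruentNum (n : ℕ) : Prop :=
  ∃ a b c : ℚ, a ^ 2 + b ^ 2 = c ^ 2 ∧ (n : ℚ) = a * b / 2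

/-- The congruent number elliptic curve `E_n : y² = x³ - n²x` over `ℚ`. -/
def congruentCurve (n : ℕ) : WeierstrassCurve.Affine ℚ :=
  { a₁ := 0, a₂ := 0, a₃ := 0, a₄ := -(n : ℚ) ^ 2, a₆ := 0 }

namespace congruentCurve

/-- If `w² - n`, `w²` and `w² + n` are rational squares and `4 ∤ n`, then `w` has even
denominator. -/
theorem two_dvd_den {n : ℕ} (hn : ¬ 4 ∣ n) {u v w : ℚ} (hu : u ^ 2 = w ^ 2 + n)
    (hv : v ^ 2 = w ^ 2 - n) : 2 ∣ w.den := by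
  by_contra hd
  have hd0 : (w.den : ℚ) ≠ 0 := by exact_mod_cast w.den_nz
  have hw : w * w.den = w.num := Rat.mul_den_eq_num w
  have hplus : IsSquare (w.num ^ 2 + n * w.den ^ 2 : ℤ) := by
    rw [← Rat.isSquare_intCast_iff]
    exact ⟨u * w.den, by push_cast; rw [← hw]; linear_combination (-(w.den : ℚ) ^ 2) * hu⟩
  have hminus : IsSquare (w.num ^ 2 - n * w.den ^ 2 : ℤ) := by
    rw [← Rat.isSquare_intCast_iff]
    exact ⟨v * w.den, by push_cast; rw [← hw]; linear_combination (-(w.den : ℚ) ^ 2) * hv⟩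
  obtain ⟨r, hr⟩ := hplus
  obtain ⟨s, hs⟩ := hminus
  have hr' := congrArg (Int.cast : ℤ → ZMod 4) hr
  have hs' := congrArg (Int.cast : ℤ → ZMod 4) hs
  have hden : (w.den : ZMod 4) ^ 2 = 1 := by
    have hodd : w.den % 4 = 1 ∨ w.den % 4 = 3 := by omega
    rw [← ZMod.natCast_mod w.den 4]
    rcases hodd with h | h <;> rw [h] <;> decide
  push_cast at hr' hs'
  rw [hden, mul_one] at hr' hs'
  have key : ∀ w n r s : ZMod 4, w ^ 2 + n = r * r → w ^ 2 - n = s * s → n = 0 := by decide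
  exact hn ((ZMod.natCast_eq_zero_iff n 4).1 (key _ _ _ _ hr' hs'))

theorem padicValRat_neg_of_dvd_den {p : ℕ} [hp : Fact p.Prime] {q : ℚ} (h : p ∣ q.den) :
    padicValRat p q < 0 := by
  have hnum : ¬ (p : ℤ) ∣ q.num := fun hdvd =>
    hp.out.one_lt.ne' (Nat.dvd_one.1 (q.reduced ▸ Nat.dvd_gcd (Int.natCast_dvd.1 hdvd) h))
  have hden := one_le_padicValNat_of_dvd q.den_nz h
  rw [padicValRat_def, padicValInt.eq_zero_of_not_dvd hnum]
  omega

theorem padicValRat_add_intCast {p : ℕ} [Fact p.Prime] {q : ℚ} (hq : padicValRat p q < 0)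
    (m : ℤ) : q + m ≠ 0 ∧ padicValRat p (q + m) = padicValRat p q := by
  have hm : 0 ≤ padicValRat p (m : ℚ) := by simp
  have hq0 : q ≠ 0 := by rintro rfl; simp at hq
  have hne : q + m ≠ 0 := by
    intro h
    rw [eq_neg_of_add_eq_zero_left h, padicValRat.neg] at hq
    omega
  refine ⟨hne, ?_⟩
  rcases eq_or_ne (m : ℚ) 0 with h0 | h0
  · rw [h0, add_zero]
  · exact padicValRat.add_eq_of_lt hne hq0 h0 (by omega)

theorem equation_iff (n : ℕ) (x y : ℚ) :
    (congruentCurve n).Equation x y ↔ y ^ 2 = x ^ 3 - (n : ℚ) ^ 2 * x := by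
  rw [WeierstrassCurve.Affine.equation_iff]
  simp [congruentCurve, sub_eq_add_neg]

theorem nonsingular_iff {n : ℕ} (hn : 0 < n) (x y : ℚ) :
    (congruentCurve n).Nonsingular x y ↔ y ^ 2 = x ^ 3 - (n : ℚ) ^ 2 * x := by
  have hn' : (n : ℚ) ≠ 0 := by exact_mod_cast hn.ne'
  have hΔ : (congruentCurve n).Δ ≠ 0 := by
    simp [congruentCurve, WeierstrassCurve.Δ, WeierstrassCurve.b₂, WeierstrassCurve.b₄,
      WeierstrassCurve.b₆, WeierstrassCurve.b₈, hn']
  rw [← WeierstrassCurve.Affine.equation_iff_nonsingular_of_Δ_ne_zero hΔ, equation_iff]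

/-- The 2-adic valuation of the `x`-coordinate, with value `0` at the point at infinity. -/
def valX {n : ℕ} : (congruentCurve n).Point → ℤ
  | .zero => 0
  | .some x _ _ => padicValRat 2 x

theorem negY_eq (n : ℕ) (x y : ℚ) : (congruentCurve n).negY x y = -y := by
  simp [congruentCurve, WeierstrassCurve.Affine.negY]

theorem two_nsmul_some {n : ℕ} {x y : ℚ} (h : (congruentCurve n).Nonsingular x y) (hy : y ≠ 0) :
    ∃ y' h', 2 • (WeierstrassCurve.Affine.Point.some x y h) =
      WeierstrassCurve.Affine.Point.some ((x ^ 2 + (n : ℚ) ^ 2) ^ 2 / (2 * y) ^ 2) y' h' := by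
  have hne : y ≠ (congruentCurve n).negY x y := by
    rw [negY_eq]
    intro h0
    exact hy (by linarith)
  have heq := (equation_iff n x y).1 h.1
  have hx : (congruentCurve n).addX x x ((congruentCurve n).slope x x y y) =
      (x ^ 2 + (n : ℚ) ^ 2) ^ 2 / (2 * y) ^ 2 := by
    rw [WeierstrassCurve.Affine.slope_of_Y_ne rfl hne, negY_eq]
    simp only [WeierstrassCurve.Affine.addX, congruentCurve]
    have h2 : y - -y = 2 * y := by ring
    rw [h2]
    field_simp
    linear_combination (-8 * x) * heq
  rw [two_nsmul, WeierstrassCurve.Affine.Point.add_self_of_Y_ne hne]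
  refine ⟨_, hx ▸ WeierstrassCurve.Affine.nonsingular_add h h fun hxy => hne hxy.2, ?_⟩
  congr 1

theorem valX_two_nsmul {n : ℕ} {P : (congruentCurve n).Point} (hP : valX P < 0) :
    valX (2 • P) = valX P - 2 := by
  rcases P with _ | ⟨x, y, h⟩
  · simp [valX] at hP
  change padicValRat 2 x < 0 at hP
  have hx0 : x ≠ 0 := by rintro rfl; simp at hP
  have hx2 : padicValRat 2 (x ^ 2) = 2 * padicValRat 2 x := by simp
  have heq := (equation_iff n x y).1 h.1
  obtain ⟨hp0, hp⟩ := padicValRat_add_intCast (p := 2) (q := x ^ 2) (by omega) ((n : ℤ) ^ 2)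
  obtain ⟨hm0, hm⟩ := padicValRat_add_intCast (p := 2) (q := x ^ 2) (by omega) (-(n : ℤ) ^ 2)
  push_cast at hp0 hp hm0 hm
  have hfac : y ^ 2 = x * (x ^ 2 + -(n : ℚ) ^ 2) := by rw [heq]; ring
  have hy : y ≠ 0 := by
    rintro rfl
    exact mul_ne_zero hx0 hm0 (by rw [← hfac]; norm_num)
  have hvy := congrArg (padicValRat 2) hfac
  rw [padicValRat.mul hx0 hm0, hm, padicValRat.pow] at hvy
  obtain ⟨y', h', h2⟩ := two_nsmul_some h hy
  rw [h2]
  change padicValRat 2 _ = padicValRat 2 x - 2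
  have h22 : padicValRat 2 (2 : ℚ) = 1 := by exact_mod_cast padicValRat.self (p := 2) one_lt_two
  rw [padicValRat.div (pow_ne_zero 2 hp0) (pow_ne_zero 2 (mul_ne_zero two_ne_zero hy)),
    padicValRat.pow, padicValRat.pow, padicValRat.mul two_ne_zero hy, hp, hx2, h22]
  push_cast at hvy ⊢
  linarith

theorem valX_two_pow_nsmul {n : ℕ} {P : (congruentCurve n).Point} (hP : valX P < 0) (k : ℕ) :
    valX (2 ^ k • P) = valX P - 2 * k := by
  induction k with
  | zero => simp
  | succ k ih =>
    rw [pow_succ', mul_nsmul', valX_two_nsmul (by omega), ih]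
    push_cast
    ring

theorem not_isOfFinAddOrder_of_valX_neg {n : ℕ} {P : (congruentCurve n).Point}
    (hP : valX P < 0) : ¬ IsOfFinAddOrder P := by
  intro hfin
  have hinj : Function.Injective fun k : ℕ => 2 ^ k • P := by
    intro k l hkl
    have := congrArg valX hkl
    simp only [valX_two_pow_nsmul hP] at this
    omega
  refine Set.infinite_of_injective_forall_mem hinj (fun k => ?_) hfin.finite_multiples
  exact ⟨2 ^ k, rfl⟩

theorem y_ne_zero_of_not_isOfFinAddOrder {n : ℕ} {x y : ℚ}
    (h : (congruentCurve n).Nonsingular x y)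
    (hP : ¬ IsOfFinAddOrder (WeierstrassCurve.Affine.Point.some x y h)) : y ≠ 0 := by
  rintro rfl
  refine hP (isOfFinAddOrder_iff_nsmul_eq_zero.2 ⟨2, two_pos, ?_⟩)
  rw [two_nsmul, WeierstrassCurve.Affine.Point.add_self_of_Y_eq (by rw [negY_eq, neg_zero])]

end congruentCurve

theorem stmt16 (n : ℕ) (hn0 : 0 < n) (hsf : Squarefree n) :
    IsCongruentNum n ↔ ∃ P : (congruentCurve n).Point, ¬ IsOfFinAddOrder P := by
  constructor
  · rintro ⟨a, b, c, habc, harea⟩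
    have h4 : ¬ 4 ∣ n := fun h => by simpa using hsf 2 h
    have hns : (congruentCurve n).Nonsingular ((c / 2) ^ 2) (c * (a ^ 2 - b ^ 2) / 8) := by
      rw [congruentCurve.nonsingular_iff hn0, harea]
      have ha : a ^ 2 = c ^ 2 - b ^ 2 := by linarith
      simp only [div_pow, mul_pow, ha]
      ring
    refine ⟨.some _ _ hns, congruentCurve.not_isOfFinAddOrder_of_valX_neg ?_⟩
    change padicValRat 2 ((c / 2) ^ 2) < 0
    have hden : 2 ∣ (c / 2).den := congruentCurve.two_dvd_den h4 (u := (a + b) / 2)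
      (v := (a - b) / 2) (by rw [harea]; linear_combination habc / 4)
      (by rw [harea]; linear_combination habc / 4)
    have hneg := congruentCurve.padicValRat_neg_of_dvd_den hden
    rw [padicValRat.pow]
    push_cast
    linarith
  · rintro ⟨P, hP⟩
    rcases P with _ | ⟨x, y, h⟩
    · exact (hP IsOfFinAddOrder.zero).elim
    have hy := congruentCurve.y_ne_zero_of_not_isOfFinAddOrder h hP
    have heq := (congruentCurve.equation_iff n x y).1 h.1
    refine ⟨(x ^ 2 - (n : ℚ) ^ 2) / y, 2 * n * x / y, (x ^ 2 + (n : ℚ) ^ 2) / y, ?_, ?_⟩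
    · field_simp
      ring
    · field_simp
      linear_combination heq
end
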